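/- arXiv:2206.05906 — 2 statements merged into one kernel-verified Lean document; each statement's English description precedes it below -/
import Mathlib

section
/- Let k be a field of characteristic zero and p a prime number. Then every irreducible homogeneous locally nilpotent derivation of rank 2 and degree p−2 on k[U,V,W] (with respect to the standard grading) is triangularizable. -/
/-- A derivation is locally nilpotent if every element is killed by some iterate. -/
def IsLND {k B : Type*} [CommRing k] [CommRing B] [Algebra k B]
    (D : Derivation k B B) : Prop :=
  ∀ b : B, ∃ n : ℕ, (⇑D)^[n] b = 0

/-- `ndeg D b n` says that `n` is the `D`-degree of `b`, i.e. the largest `m` with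
`D^[m] b ≠ 0`. -/
def ndeg {k B : Type*} [CommRing k] [CommRing B] [Algebra k B]
    (D : Derivation k B B) (b : B) (n : ℕ) : Prop :=
  (⇑D)^[n] b ≠ 0 ∧ (⇑D)^[n + 1] b = 0

/-- A derivation is irreducible if the ideal generated by its image is not contained
in any proper principal ideal. -/
def IsIrred {k B : Type*} [CommRing k] [CommRing B] [Algebra k B]
    (D : Derivation k B B) : Prop :=
  ∀ b : B, Ideal.span (Set.range (⇑D)) ≤ Ideal.span {b} → IsUnit b

open MvPolynomial

/-- The Jacobian derivation `g ↦ ∂(f₁,f₂,g)/∂(X₀,X₁,X₂)` on `k[X₀,X₁,X₂]`. -/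
noncomputable def jac {k : Type*} [CommRing k]
    (f₁ f₂ g : MvPolynomial (Fin 3) k) : MvPolynomial (Fin 3) k :=
  Matrix.det (Matrix.of fun i j => MvPolynomial.pderiv j (![f₁, f₂, g] i))

/-- `V 0, V 1, V 2` form a system of coordinates (variables) of `k[X₀,X₁,X₂]`. -/
def IsCoordSys {k : Type*} [CommRing k]
    (V : Fin 3 → MvPolynomial (Fin 3) k) : Prop :=
  ∃ σ : MvPolynomial (Fin 3) k ≃ₐ[k] MvPolynomial (Fin 3) k,
    ∀ i, σ (X i) = V i

/-- `D` is homogeneous of degree `d` with respect to the standard grading. -/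
def IsHomogDer {k : Type*} [CommRing k]
    (D : Derivation k (MvPolynomial (Fin 3) k) (MvPolynomial (Fin 3) k))
    (d : ℕ) : Prop :=
  ∀ (i : ℕ) (f : MvPolynomial (Fin 3) k),
    f.IsHomogeneous i → (D f).IsHomogeneous (i + d)

/-- `D` has rank 2: some coordinate system has its last variable in the kernel, but no
coordinate system has its last two variables in the kernel. -/
def HasRank2 {k : Type*} [CommRing k]
    (D : Derivation k (MvPolynomial (Fin 3) k) (MvPolynomial (Fin 3) k)) : Prop :=
  (∃ V : Fin 3 → MvPolynomial (Fin 3) k, IsCoordSys V ∧ D (V 2) = 0) ∧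
  ¬ (∃ V : Fin 3 → MvPolynomial (Fin 3) k, IsCoordSys V ∧ D (V 1) = 0 ∧ D (V 2) = 0)

/-- `D` is triangularizable: in some coordinate system `{X,Y,Z}` one has `D X ∈ k`,
`D Y ∈ k[X]`, `D Z ∈ k[X,Y]`. -/
def IsTriangularizable {k : Type*} [CommRing k]
    (D : Derivation k (MvPolynomial (Fin 3) k) (MvPolynomial (Fin 3) k)) : Prop :=
  ∃ V : Fin 3 → MvPolynomial (Fin 3) k, IsCoordSys V ∧
    (∃ c : k, D (V 0) = C c) ∧
    D (V 1) ∈ Algebra.adjoin k ({V 0} : Set (MvPolynomial (Fin 3) k)) ∧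
    D (V 2) ∈ Algebra.adjoin k ({V 0, V 1} : Set (MvPolynomial (Fin 3) k))


section LNDGeneral

variable {k B : Type*} [CommRing k] [CommRing B] [Algebra k B]

lemma lnd_iter_zero (D : Derivation k B B) (n : ℕ) : (⇑D)^[n] (0 : B) = 0 := by
  induction n with
  | zero => rfl
  | succ n ih => rw [Function.iterate_succ_apply, map_zero, ih]

lemma lnd_iter_add (D : Derivation k B B) (n : ℕ) (a b : B) :
    (⇑D)^[n] (a + b) = (⇑D)^[n] a + (⇑D)^[n] b := by
  induction n generalizing a b with
  | zero => rfl
  | succ n ih => simp only [Function.iterate_succ_apply, map_add, ih]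

lemma lnd_iter_of_le (D : Derivation k B B) {n m : ℕ} (h : n ≤ m) {a : B}
    (ha : (⇑D)^[n] a = 0) : (⇑D)^[m] a = 0 := by
  obtain ⟨c, rfl⟩ := Nat.exists_eq_add_of_le h
  rw [Nat.add_comm, Function.iterate_add_apply, ha, lnd_iter_zero]

/-- Iterated Leibniz rule in top degree. -/
lemma lnd_leibniz (D : Derivation k B B) (N : ℕ) : ∀ (n m : ℕ) (f g : B), n + m = N →
    (⇑D)^[n + 1] f = 0 → (⇑D)^[m + 1] g = 0 →
    (⇑D)^[N] (f * g) = (Nat.choose N n : B) * ((⇑D)^[n] f * (⇑D)^[m] g) ∧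
      (⇑D)^[N + 1] (f * g) = 0 := by
  induction N with
  | zero =>
    intro n m f g h hf hg
    obtain rfl : n = 0 := by omega
    obtain rfl : m = 0 := by omega
    have hf' : D f = 0 := hf
    have hg' : D g = 0 := hg
    simp [hf', hg']
  | succ N ih =>
    intro n m f g h hf hg
    have key : ∀ r, (⇑D)^[r + 1] (f * g) = (⇑D)^[r] (f * D g) + (⇑D)^[r] (D f * g) := by
      intro r
      rw [Function.iterate_succ_apply, Derivation.leibniz, lnd_iter_add, smul_eq_mul, smul_eq_mul,
        mul_comm g]
    have h1 : (⇑D)^[N] (D f * g) = (if n = 0 then 0 else (Nat.choose N (n - 1) : B)) *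
        ((⇑D)^[n] f * (⇑D)^[m] g) ∧ (⇑D)^[N + 1] (D f * g) = 0 := by
      rcases n with _ | n
      · have hf' : D f = 0 := hf
        simp [hf']
      · have := ih n m (D f) g (by omega) hf hg
        simpa using this
    have h2 : (⇑D)^[N] (f * D g) = (if m = 0 then 0 else (Nat.choose N n : B)) *
        ((⇑D)^[n] f * (⇑D)^[m] g) ∧ (⇑D)^[N + 1] (f * D g) = 0 := by
      rcases m with _ | m
      · have hg' : D g = 0 := hg
        simp [hg']
      · have := ih n m f (D g) (by omega) hf hg
        simpa using this
    refine ⟨?_, ?_⟩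
    · rw [key, h1.1, h2.1, ← add_mul]
      congr 1
      rcases n with _ | n
      · rcases m with _ | m
        · omega
        · simp
      · rcases m with _ | m
        · obtain rfl : n = N := by omega
          simp
        · simp [Nat.choose_succ_succ, add_comm]
    · rw [key, h1.2, h2.2, add_zero]

lemma lnd_exists_ndeg (D : Derivation k B B) (h : IsLND D) {f : B} (hf : f ≠ 0) :
    ∃ n, ndeg D f n := by
  classical
  have hex := h f
  have hs := Nat.find_spec hex
  have h0 : Nat.find hex ≠ 0 := by
    intro h0
    rw [h0] at hs
    exact hf hs
  obtain ⟨n, hn⟩ := Nat.exists_eq_succ_of_ne_zero h0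
  refine ⟨n, ?_, ?_⟩
  · exact Nat.find_min hex (by omega)
  · rw [hn] at hs
    exact hs

lemma ndeg_unique (D : Derivation k B B) {f : B} {n m : ℕ} (hn : ndeg D f n)
    (hm : ndeg D f m) : n = m := by
  rcases lt_trichotomy n m with h | h | h
  · exact absurd (lnd_iter_of_le D h hn.2) hm.1
  · exact h
  · exact absurd (lnd_iter_of_le D h hm.2) hn.1

lemma ndeg_mul [IsDomain B] [CharZero B] (D : Derivation k B B) {f g : B} {n m : ℕ}
    (hn : ndeg D f n) (hm : ndeg D g m) : ndeg D (f * g) (n + m) := by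
  have := lnd_leibniz D (n + m) n m f g rfl hn.2 hm.2
  refine ⟨?_, this.2⟩
  rw [this.1]
  have : Nat.choose (n + m) n ≠ 0 := (Nat.choose_pos (by omega)).ne'
  exact mul_ne_zero (by exact_mod_cast this) (mul_ne_zero hn.1 hm.1)

lemma ndeg_D (D : Derivation k B B) {f : B} {n : ℕ} (h : ndeg D (D f) n) : ndeg D f (n + 1) :=
  h

lemma lnd_nilp_mul (D : Derivation k B B) {f g : B} (hf : ∃ n, (⇑D)^[n] f = 0)
    (hg : ∃ n, (⇑D)^[n] g = 0) : ∃ n, (⇑D)^[n] (f * g) = 0 := by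
  obtain ⟨n, hn⟩ := hf
  obtain ⟨m, hm⟩ := hg
  exact ⟨_, (lnd_leibniz D (n + m) n m f g rfl (lnd_iter_of_le D (by omega) hn)
    (lnd_iter_of_le D (by omega) hm)).2⟩

lemma lnd_nilp_add (D : Derivation k B B) {f g : B} (hf : ∃ n, (⇑D)^[n] f = 0)
    (hg : ∃ n, (⇑D)^[n] g = 0) : ∃ n, (⇑D)^[n] (f + g) = 0 := by
  obtain ⟨n, hn⟩ := hf
  obtain ⟨m, hm⟩ := hg
  exact ⟨n + m, by rw [lnd_iter_add, lnd_iter_of_le D (by omega) hn,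
    lnd_iter_of_le D (by omega) hm, add_zero]⟩

lemma lnd_dvd [IsDomain B] [CharZero B] (D : Derivation k B B) (h : IsLND D) {f : B}
    (hd : f ∣ D f) : D f = 0 := by
  by_contra h0
  obtain ⟨g, hg⟩ := hd
  have hf : f ≠ 0 := by rintro rfl; simp at h0
  have hg0 : g ≠ 0 := by rintro rfl; simp [hg] at h0
  obtain ⟨n, hn⟩ := lnd_exists_ndeg D h h0
  obtain ⟨m, hm⟩ := lnd_exists_ndeg D h hg0
  have h1 := ndeg_D D hn
  have h2 := ndeg_mul D h1 hm
  rw [← hg] at h2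
  have := ndeg_unique D hn h2
  omega

lemma lnd_dvd_two [IsDomain B] [CharZero B] (D : Derivation k B B) (h : IsLND D) {f : B}
    (hd : f ∣ D (D f)) : D (D f) = 0 := by
  by_contra h0
  obtain ⟨g, hg⟩ := hd
  have hf : f ≠ 0 := by rintro rfl; simp at h0
  have hg0 : g ≠ 0 := by rintro rfl; simp [hg] at h0
  obtain ⟨n, hn⟩ := lnd_exists_ndeg D h h0
  obtain ⟨m, hm⟩ := lnd_exists_ndeg D h hg0
  have h1 := ndeg_D D (ndeg_D D hn)
  have h2 := ndeg_mul D h1 hm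
  rw [← hg] at h2
  have := ndeg_unique D hn h2
  omega

lemma lnd_ker_factor [IsDomain B] [CharZero B] (D : Derivation k B B) (h : IsLND D) {f g : B}
    (hg : g ≠ 0) (hd : D g = 0) (hfg : f ∣ g) : D f = 0 := by
  by_contra h0
  obtain ⟨r, rfl⟩ := hfg
  have hr0 : r ≠ 0 := by rintro rfl; simp at hg
  obtain ⟨n, hn⟩ := lnd_exists_ndeg D h h0
  obtain ⟨m, hm⟩ := lnd_exists_ndeg D h hr0
  have h1 := ndeg_mul D (ndeg_D D hn) hm
  have h2 : ndeg D (f * r) 0 := ⟨hg, hd⟩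
  have := ndeg_unique D h1 h2
  omega

lemma lnd_cross [IsDomain B] [CharZero B] (D : Derivation k B B) (h : IsLND D) {x y : B}
    (hx : y ∣ D x) (hy : x ∣ D y) (hx0 : D x ≠ 0) : D y = 0 := by
  by_contra hy0
  obtain ⟨r, hr⟩ := hx
  obtain ⟨s, hs⟩ := hy
  have hr0 : r ≠ 0 := by rintro rfl; simp [hr] at hx0
  have hs0 : s ≠ 0 := by rintro rfl; simp [hs] at hy0
  obtain ⟨n, hn⟩ := lnd_exists_ndeg D h hx0
  obtain ⟨m, hm⟩ := lnd_exists_ndeg D h hy0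
  obtain ⟨n', hn'⟩ := lnd_exists_ndeg D h hr0
  obtain ⟨m', hm'⟩ := lnd_exists_ndeg D h hs0
  have h1 := ndeg_mul D (ndeg_D D hm) hn'
  have h2 := ndeg_mul D (ndeg_D D hn) hm'
  rw [← hr] at h1
  rw [← hs] at h2
  have := ndeg_unique D h1 hn
  have := ndeg_unique D h2 hm
  omega

end LNDGeneral

section Poly

variable {k : Type*} [Field k]

lemma lnd_poly_of_X (D : Derivation k (MvPolynomial (Fin 3) k) (MvPolynomial (Fin 3) k))
    (h : ∀ i, ∃ n, (⇑D)^[n] (X i) = 0) : IsLND D := by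
  intro f
  induction f using MvPolynomial.induction_on with
  | C a => exact ⟨1, by simp⟩
  | add p q hp hq => exact lnd_nilp_add D hp hq
  | mul_X p i hp => exact lnd_nilp_mul D hp (h i)

lemma lnd_poly_of_monomial (D : Derivation k (MvPolynomial (Fin 3) k) (MvPolynomial (Fin 3) k))
    (h : ∀ m c, ∃ n, (⇑D)^[n] (monomial m c) = 0) : IsLND D := by
  intro f
  induction f using MvPolynomial.induction_on' with
  | monomial m c => exact h m c
  | add p q hp hq => exact lnd_nilp_add D hp hq

lemma pderiv_isLND (i : Fin 3) : IsLND (pderiv i : Derivation k (MvPolynomial (Fin 3) k) _) := by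
  apply lnd_poly_of_X
  intro j
  refine ⟨2, ?_⟩
  by_cases hij : j = i
  · subst hij; simp [Function.iterate_succ_apply]
  · simp [Function.iterate_succ_apply, pderiv_X_of_ne hij]

lemma der_expand (D : Derivation k (MvPolynomial (Fin 3) k) (MvPolynomial (Fin 3) k))
    (f : MvPolynomial (Fin 3) k) : D f = ∑ i, pderiv i f * D (X i) := by
  have : D = D (X 0) • (pderiv 0 : Derivation k (MvPolynomial (Fin 3) k) _) +
      D (X 1) • (pderiv 1 : Derivation k (MvPolynomial (Fin 3) k) _) +
      D (X 2) • (pderiv 2 : Derivation k (MvPolynomial (Fin 3) k) _) := by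
    apply derivation_ext
    intro j
    fin_cases j <;> simp [pderiv_X]
  conv_lhs => rw [this]
  simp [Fin.sum_univ_three, mul_comm]

/-- support of `D f` -/
lemma der_support (D : Derivation k (MvPolynomial (Fin 3) k) (MvPolynomial (Fin 3) k))
    (f : MvPolynomial (Fin 3) k) {m : Fin 3 →₀ ℕ} (hm : coeff m (D f) ≠ 0) :
    ∃ i a b, coeff (a + Finsupp.single i 1) f ≠ 0 ∧ coeff b (D (X i)) ≠ 0 ∧ m = a + b := by
  classical
  rw [der_expand, coeff_sum] at hm
  obtain ⟨i, -, hi⟩ := Finset.exists_ne_zero_of_sum_ne_zero hm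
  rw [coeff_mul] at hi
  obtain ⟨⟨a, b⟩, hab, h⟩ := Finset.exists_ne_zero_of_sum_ne_zero hi
  rw [Finset.HasAntidiagonal.mem_antidiagonal] at hab
  refine ⟨i, a, b, ?_, right_ne_zero_of_mul h, hab.symm⟩
  have := left_ne_zero_of_mul h
  simp only [coeff_pderiv] at this
  exact left_ne_zero_of_mul this

lemma const_of_pderiv [CharZero k] (f : MvPolynomial (Fin 3) k) (h : ∀ i, pderiv i f = 0) :
    ∃ c, f = C c := by
  classical
  refine ⟨coeff 0 f, ?_⟩
  ext m
  rw [coeff_C]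
  split_ifs with h0
  · rw [← h0]
  · obtain ⟨i, hi⟩ := Finsupp.ne_iff.mp (Ne.symm h0)
    have h1 : m - Finsupp.single i 1 + Finsupp.single i 1 = m := by
      ext j
      by_cases hj : j = i
      · subst hj
        simp at hi ⊢
        omega
      · simp [Ne.symm hj]
    have := congrArg (coeff (m - Finsupp.single i 1)) (h i)
    rw [coeff_pderiv, h1, coeff_zero] at this
    rcases mul_eq_zero.mp this with h2 | h2
    · exact h2
    · exact absurd h2 (Nat.cast_add_one_ne_zero _)

/-- Vanishing Wronskians give proportionality. -/
lemma proportional_of_wronskian [CharZero k] (a b : MvPolynomial (Fin 3) k) (hb : b ≠ 0)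
    (h : ∀ i, pderiv i a * b = a * pderiv i b) : ∃ c, a = C c * b := by
  obtain ⟨a', b', c', hrel, hca, hcb⟩ := UniqueFactorizationMonoid.exists_reduced_factors' a b hb
  have hc0 : c' ≠ 0 := by rintro rfl; simp at hcb; exact hb hcb.symm
  have hb0 : b' ≠ 0 := by rintro rfl; simp at hcb; exact hb hcb.symm
  have key : ∀ i, pderiv i a' * b' = a' * pderiv i b' := by
    intro i
    have := h i
    rw [← hca, ← hcb, pderiv_mul, pderiv_mul] at this
    have h2 : (c' * c') * (pderiv i a' * b') = (c' * c') * (a' * pderiv i b') := by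
      linear_combination this
    exact mul_left_cancel₀ (mul_ne_zero hc0 hc0) h2
  have ha : ∀ i, pderiv i a' = 0 := by
    intro i
    apply lnd_dvd _ (pderiv_isLND i)
    exact hrel.dvd_of_dvd_mul_right (Dvd.intro _ (key i).symm)
  have hbb : ∀ i, pderiv i b' = 0 := by
    intro i
    apply lnd_dvd _ (pderiv_isLND i)
    exact hrel.symm.dvd_of_dvd_mul_left (Dvd.intro_left _ (key i))
  obtain ⟨c, hc⟩ := const_of_pderiv a' ha
  obtain ⟨d, hd⟩ := const_of_pderiv b' hbb
  have hd0 : d ≠ 0 := by rintro rfl; simp [hd] at hb0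
  refine ⟨c * d⁻¹, ?_⟩
  rw [← hca, ← hcb, hc, hd]
  have : (C d⁻¹ : MvPolynomial (Fin 3) k) * C d = 1 := by rw [← C_mul, inv_mul_cancel₀ hd0, C_1]
  rw [C_mul]
  linear_combination -(c' * C c) * this

end Poly

section Top

variable {k : Type*} [Field k]

/-- The weight of an exponent for the grading with weights `(0, w1, w2)`. -/
def wt (w1 w2 : ℤ) (m : Fin 3 →₀ ℕ) : ℤ := w1 * m 1 + w2 * m 2

lemma wt_add (w1 w2 : ℤ) (m n : Fin 3 →₀ ℕ) : wt w1 w2 (m + n) = wt w1 w2 m + wt w1 w2 n := by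
  simp only [wt, Finsupp.add_apply]
  push_cast
  ring

lemma wt_single0 (w1 w2 : ℤ) : wt w1 w2 (Finsupp.single 0 1) = 0 := by simp [wt]
lemma wt_single1 (w1 w2 : ℤ) : wt w1 w2 (Finsupp.single 1 1) = w1 := by simp [wt]
lemma wt_single2 (w1 w2 : ℤ) : wt w1 w2 (Finsupp.single 2 1) = w2 := by simp [wt]

open Classical in
/-- The part of `f` supported on the exponents satisfying `P`. -/
noncomputable def restr (P : (Fin 3 →₀ ℕ) → Prop) (f : MvPolynomial (Fin 3) k) :
    MvPolynomial (Fin 3) k :=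
  ∑ m ∈ f.support.filter P, monomial m (coeff m f)

open Classical in
lemma coeff_restr (P : (Fin 3 →₀ ℕ) → Prop) (f : MvPolynomial (Fin 3) k) (m : Fin 3 →₀ ℕ) :
    coeff m (restr P f) = if P m then coeff m f else 0 := by
  rw [restr, coeff_sum]
  simp only [coeff_monomial]
  rw [Finset.sum_ite_eq']
  by_cases h : P m
  · by_cases h2 : coeff m f = 0
    · simp [h2]
    · simp [h, h2]
  · simp [h]

lemma coeff_restr_ne {P : (Fin 3 →₀ ℕ) → Prop} {f : MvPolynomial (Fin 3) k} {m : Fin 3 →₀ ℕ}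
    (h : coeff m (restr P f) ≠ 0) : P m ∧ coeff m f ≠ 0 := by
  classical
  rw [coeff_restr] at h
  split_ifs at h with h1
  · exact ⟨h1, h⟩
  · exact absurd rfl h

lemma coeff_restr_pos {P : (Fin 3 →₀ ℕ) → Prop} {f : MvPolynomial (Fin 3) k} {m : Fin 3 →₀ ℕ}
    (h : P m) : coeff m (restr P f) = coeff m f := by
  classical
  rw [coeff_restr, if_pos h]

/-- The degree-`e` homogeneous part of `D` for the weights `(0, w1, w2)`. -/
noncomputable def topDer (w1 w2 e : ℤ)
    (D : Derivation k (MvPolynomial (Fin 3) k) (MvPolynomial (Fin 3) k)) :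
    Derivation k (MvPolynomial (Fin 3) k) (MvPolynomial (Fin 3) k) :=
  mkDerivation k (fun i => restr (fun m => wt w1 w2 m = wt w1 w2 (Finsupp.single i 1) + e)
    (D (X i)))

lemma topDer_X (w1 w2 e : ℤ)
    (D : Derivation k (MvPolynomial (Fin 3) k) (MvPolynomial (Fin 3) k)) (i : Fin 3) :
    topDer w1 w2 e D (X i) =
      restr (fun m => wt w1 w2 m = wt w1 w2 (Finsupp.single i 1) + e) (D (X i)) := by
  rw [topDer, mkDerivation_X]

lemma der_wt (w1 w2 : ℤ) (Q R : ℤ → Prop)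
    (D : Derivation k (MvPolynomial (Fin 3) k) (MvPolynomial (Fin 3) k)) (f)
    (hf : ∀ m, coeff m f ≠ 0 → Q (wt w1 w2 m))
    (hD : ∀ i m n, coeff m (D (X i)) ≠ 0 → Q n →
      R (n + (wt w1 w2 m - wt w1 w2 (Finsupp.single i 1)))) :
    ∀ m, coeff m (D f) ≠ 0 → R (wt w1 w2 m) := by
  intro m hm
  obtain ⟨i, a, b, h1, h2, rfl⟩ := der_support D f hm
  have := hD i b _ h2 (hf _ h1)
  rw [wt_add] at this
  rw [wt_add]
  convert this using 1
  ring

lemma topDer_isLND (w1 w2 e : ℤ)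
    (D : Derivation k (MvPolynomial (Fin 3) k) (MvPolynomial (Fin 3) k)) (hD : IsLND D)
    (hle : ∀ i m, coeff m (D (X i)) ≠ 0 → wt w1 w2 m ≤ wt w1 w2 (Finsupp.single i 1) + e) :
    IsLND (topDer w1 w2 e D) := by
  apply lnd_poly_of_monomial
  intro m c
  obtain ⟨N, hN⟩ := hD (monomial m c)
  refine ⟨N, ?_⟩
  have key : ∀ r : ℕ,
      (∀ s, coeff s ((⇑(topDer w1 w2 e D))^[r] (monomial m c)) ≠ 0 →
        wt w1 w2 s = wt w1 w2 m + r * e) ∧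
      (∀ s, coeff s ((⇑D)^[r] (monomial m c) - (⇑(topDer w1 w2 e D))^[r] (monomial m c)) ≠ 0 →
        wt w1 w2 s < wt w1 w2 m + r * e) := by
    intro r
    induction r with
    | zero =>
      refine ⟨?_, ?_⟩
      · intro s hs
        simp only [Function.iterate_zero, id, coeff_monomial] at hs
        split_ifs at hs with h
        · simp [h]
        · exact absurd rfl hs
      · intro s hs
        simp at hs
    | succ r ih =>
      obtain ⟨ih1, ih2⟩ := ih
      refine ⟨?_, ?_⟩
      · intro s hs
        rw [Function.iterate_succ_apply'] at hs
        refine der_wt w1 w2 (fun n => n = wt w1 w2 m + r * e)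
          (fun n => n = wt w1 w2 m + ((r + 1 : ℕ) : ℤ) * e) _ _ ih1 ?_ s hs
        intro i t n ht hn
        rw [topDer_X] at ht
        have := (coeff_restr_ne ht).1
        push_cast
        linarith
      · intro s hs
        rw [Function.iterate_succ_apply', Function.iterate_succ_apply'] at hs
        have hsplit : D ((⇑D)^[r] (monomial m c)) -
            topDer w1 w2 e D ((⇑(topDer w1 w2 e D))^[r] (monomial m c)) =
            D ((⇑D)^[r] (monomial m c) - (⇑(topDer w1 w2 e D))^[r] (monomial m c)) +
            (D - topDer w1 w2 e D) ((⇑(topDer w1 w2 e D))^[r] (monomial m c)) := by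
          rw [map_sub, Derivation.sub_apply]
          ring
        rw [hsplit, coeff_add] at hs
        have h2 : coeff s (D ((⇑D)^[r] (monomial m c) -
              (⇑(topDer w1 w2 e D))^[r] (monomial m c))) ≠ 0 ∨
            coeff s ((D - topDer w1 w2 e D) ((⇑(topDer w1 w2 e D))^[r] (monomial m c))) ≠ 0 := by
          by_contra hcon
          push Not at hcon
          rw [hcon.1, hcon.2, add_zero] at hs
          exact hs rfl
        rcases h2 with h2 | h2
        · refine der_wt w1 w2 (fun n => n < wt w1 w2 m + r * e)
            (fun n => n < wt w1 w2 m + ((r + 1 : ℕ) : ℤ) * e) _ _ ih2 ?_ s h2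
          intro i t n ht hn
          have := hle i t ht
          push_cast
          linarith
        · refine der_wt w1 w2 (fun n => n = wt w1 w2 m + r * e)
            (fun n => n < wt w1 w2 m + ((r + 1 : ℕ) : ℤ) * e) _ _ ih1 ?_ s h2
          intro i t n ht hn
          have : wt w1 w2 t < wt w1 w2 (Finsupp.single i 1) + e := by
            rw [Derivation.sub_apply, topDer_X, coeff_sub] at ht
            rcases eq_or_ne (wt w1 w2 t) (wt w1 w2 (Finsupp.single i 1) + e) with h | h
            · rw [coeff_restr_pos h, sub_self] at ht
              exact absurd rfl ht
            · refine lt_of_le_of_ne (hle i t ?_) h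
              intro h0
              rw [h0, zero_sub, neg_ne_zero] at ht
              exact h (coeff_restr_ne ht).1
          push_cast
          linarith
  obtain ⟨k1, k2⟩ := key N
  ext s
  rw [coeff_zero]
  by_contra hs
  have h1 := k1 s hs
  rw [hN, zero_sub] at k2
  have h2 := k2 s (by rwa [coeff_neg, neg_ne_zero])
  linarith

lemma weighted_euler (w1 w2 n : ℤ) (f : MvPolynomial (Fin 3) k)
    (hf : ∀ m, coeff m f ≠ 0 → wt w1 w2 m = n) :
    (w1 : MvPolynomial (Fin 3) k) * (X 1 * pderiv 1 f) +
      (w2 : MvPolynomial (Fin 3) k) * (X 2 * pderiv 2 f) = (n : MvPolynomial (Fin 3) k) * f := by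
  have hsum : f = ∑ m ∈ f.support, monomial m (coeff m f) := f.as_sum
  have e1 : ∀ i : Fin 3, X i * pderiv i f =
      ∑ m ∈ f.support, (m i : MvPolynomial (Fin 3) k) * monomial m (coeff m f) := by
    intro i
    conv_lhs => rw [hsum]
    rw [map_sum, Finset.mul_sum]
    refine Finset.sum_congr rfl fun m _ => ?_
    rw [X_mul_pderiv_monomial, nsmul_eq_mul]
  rw [e1, e1]
  conv_rhs => rw [hsum]
  rw [Finset.mul_sum, Finset.mul_sum, Finset.mul_sum, ← Finset.sum_add_distrib]
  refine Finset.sum_congr rfl fun m hm => ?_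
  have := hf m (mem_support_iff.mp hm)
  rw [← this, wt]
  push_cast
  ring

/-- The element `w1 Y D(Z) - w2 Z D(Y)` is killed by a homogeneous lnd, as it is an eigenvector. -/
lemma q_ker [CharZero k] (w1 w2 e : ℤ)
    (D : Derivation k (MvPolynomial (Fin 3) k) (MvPolynomial (Fin 3) k)) (hD : IsLND D)
    (h0 : D (X 0) = 0)
    (h1 : ∀ m, coeff m (D (X 1)) ≠ 0 → wt w1 w2 m = w1 + e)
    (h2 : ∀ m, coeff m (D (X 2)) ≠ 0 → wt w1 w2 m = w2 + e) :
    D ((w1 : MvPolynomial (Fin 3) k) * X 1 * D (X 2) -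
      (w2 : MvPolynomial (Fin 3) k) * X 2 * D (X 1)) =
      (pderiv 1 (D (X 1)) + pderiv 2 (D (X 2))) *
        ((w1 : MvPolynomial (Fin 3) k) * X 1 * D (X 2) -
      (w2 : MvPolynomial (Fin 3) k) * X 2 * D (X 1)) ∧
    D ((w1 : MvPolynomial (Fin 3) k) * X 1 * D (X 2) -
      (w2 : MvPolynomial (Fin 3) k) * X 2 * D (X 1)) = 0 := by
  have E1 := weighted_euler _ _ _ _ h1
  have E2 := weighted_euler _ _ _ _ h2
  have x1 := der_expand D (D (X 1))
  have x2 := der_expand D (D (X 2))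
  rw [Fin.sum_univ_three, h0] at x1 x2
  have key : D ((w1 : MvPolynomial (Fin 3) k) * X 1 * D (X 2) -
      (w2 : MvPolynomial (Fin 3) k) * X 2 * D (X 1)) =
      (pderiv 1 (D (X 1)) + pderiv 2 (D (X 2))) *
        ((w1 : MvPolynomial (Fin 3) k) * X 1 * D (X 2) -
      (w2 : MvPolynomial (Fin 3) k) * X 2 * D (X 1)) := by
    have c1 : D (w1 : MvPolynomial (Fin 3) k) = 0 := Derivation.map_intCast _ _
    have c2 : D (w2 : MvPolynomial (Fin 3) k) = 0 := Derivation.map_intCast _ _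
    simp only [map_sub, Derivation.leibniz, smul_eq_mul, c1, c2]
    push_cast at E1 E2
    linear_combination (w1 : MvPolynomial (Fin 3) k) * X 1 * x2 -
      (w2 : MvPolynomial (Fin 3) k) * X 2 * x1 + D (X 1) * E2 - D (X 2) * E1
  exact ⟨key, lnd_dvd D hD (Dvd.intro_left _ key.symm)⟩

/-- Structure of the homogeneous lnd's in two variables (standard grading). -/
lemma step_one [CharZero k] (n : ℕ) (hn : 1 ≤ n)
    (D : Derivation k (MvPolynomial (Fin 3) k) (MvPolynomial (Fin 3) k)) (hD : IsLND D)
    (h0 : D (X 0) = 0)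
    (ha : ∀ m, coeff m (D (X 1)) ≠ 0 → m 0 = 0 ∧ m 1 + m 2 = n)
    (hb : ∀ m, coeff m (D (X 2)) ≠ 0 → m 0 = 0 ∧ m 1 + m 2 = n) :
    D (D (X 1)) = 0 ∧ D (D (X 2)) = 0 ∧
      (D (X 2) ≠ 0 → ∃ c, D (X 1) = C c * D (X 2)) := by
  have h1 : ∀ m, coeff m (D (X 1)) ≠ 0 → wt 1 1 m = n := by
    intro m hm
    have := (ha m hm).2
    simp only [wt]
    omega
  have h2 : ∀ m, coeff m (D (X 2)) ≠ 0 → wt 1 1 m = n := by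
    intro m hm
    have := (hb m hm).2
    simp only [wt]
    omega
  obtain ⟨k1, k2⟩ := q_ker 1 1 (n - 1) D hD h0 (fun m hm => by rw [h1 m hm]; ring)
    (fun m hm => by rw [h2 m hm]; ring)
  rw [k2] at k1
  simp only [Int.cast_one, one_mul] at k1
  by_cases hq : (X 1 * D (X 2) - X 2 * D (X 1) : MvPolynomial (Fin 3) k) = 0
  · have hdvd : (X 2 : MvPolynomial (Fin 3) k) ∣ X 1 * D (X 2) := Dvd.intro _ (sub_eq_zero.mp hq).symm
    have hb0 : D (X 2) = 0 := by
      apply lnd_dvd D hD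
      rcases ((X_prime : Prime (X 2 : MvPolynomial (Fin 3) k)).dvd_mul).mp hdvd with h | h
      · rw [X_dvd_X] at h
        simp at h
      · exact h
    rw [hb0, mul_zero, zero_sub, neg_eq_zero] at hq
    have ha0 : D (X 1) = 0 := by
      rcases mul_eq_zero.mp hq with h | h
      · exact absurd h (X_ne_zero _)
      · exact h
    simp [ha0, hb0]
  · have hdiv : pderiv 1 (D (X 1)) + pderiv 2 (D (X 2)) = 0 := by
      rcases mul_eq_zero.mp k1.symm with h | h
      · exact h
      · exact absurd h hq
    have E1 := weighted_euler _ _ _ _ h1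
    have E2 := weighted_euler _ _ _ _ h2
    have x1 := der_expand D (D (X 1))
    have x2 := der_expand D (D (X 2))
    rw [Fin.sum_univ_three, h0] at x1 x2
    simp only [Int.cast_one, one_mul, Int.cast_natCast] at E1 E2
    have hn0 : (C (n : k) : MvPolynomial (Fin 3) k) ≠ 0 := by
      rw [Ne, C_eq_zero]
      exact_mod_cast (by omega : n ≠ 0)
    have hCn : (C ((n : k)⁻¹) : MvPolynomial (Fin 3) k) * n = 1 := by
      have : (n : MvPolynomial (Fin 3) k) = C (n : k) := by simp
      rw [this, ← C_mul, inv_mul_cancel₀ (by exact_mod_cast (by omega : n ≠ 0)), C_1]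
    have A : D (D (X 1)) = 0 := by
      apply lnd_dvd_two D hD
      refine ⟨C ((n : k)⁻¹) * (pderiv 1 (D (X 1)) * pderiv 1 (D (X 1)) +
        pderiv 2 (D (X 1)) * pderiv 1 (D (X 2))), ?_⟩
      linear_combination x1 - (pderiv 1 (D (X 1)) * D (X 1) + pderiv 2 (D (X 1)) * D (X 2)) * hCn -
        C ((n : k)⁻¹) * pderiv 1 (D (X 1)) * E1 - C ((n : k)⁻¹) * pderiv 2 (D (X 1)) * E2 +
        C ((n : k)⁻¹) * X 2 * pderiv 2 (D (X 1)) * hdiv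
    have B : D (D (X 2)) = 0 := by
      apply lnd_dvd_two D hD
      refine ⟨C ((n : k)⁻¹) * (pderiv 2 (D (X 2)) * pderiv 2 (D (X 2)) +
        pderiv 1 (D (X 2)) * pderiv 2 (D (X 1))), ?_⟩
      linear_combination x2 - (pderiv 1 (D (X 2)) * D (X 1) + pderiv 2 (D (X 2)) * D (X 2)) * hCn -
        C ((n : k)⁻¹) * pderiv 1 (D (X 2)) * E1 - C ((n : k)⁻¹) * pderiv 2 (D (X 2)) * E2 +
        C ((n : k)⁻¹) * X 1 * pderiv 1 (D (X 2)) * hdiv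
    refine ⟨A, B, fun hb0 => ?_⟩
    apply proportional_of_wronskian _ _ hb0
    have z : ∀ f : MvPolynomial (Fin 3) k, (∀ m, coeff m f ≠ 0 → m 0 = 0 ∧ m 1 + m 2 = n) →
        pderiv 0 f = 0 := by
      intro f hf
      ext m
      rw [coeff_pderiv, coeff_zero]
      by_contra hm
      have := (hf _ (left_ne_zero_of_mul hm)).1
      simp at this
    intro i
    fin_cases i
    · simp [z _ ha, z _ hb]
    · simp only [Fin.mk_one]
      linear_combination D (X 2) * hdiv + x2 - B
    · simp only [Fin.reduceFinMk]
      linear_combination -x1 + A - D (X 1) * hdiv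

end Top

section Core

variable {k : Type*} [Field k]

lemma X_dvd_of_coeff (i : Fin 3) (f : MvPolynomial (Fin 3) k)
    (h : ∀ m, coeff m f ≠ 0 → m i ≠ 0) : X i ∣ f := by
  rw [f.as_sum]
  refine Finset.dvd_sum fun m hm => ?_
  rw [mem_support_iff] at hm
  have h1 : Finsupp.single i 1 + (m - Finsupp.single i 1) = m := by
    ext j
    have := h m hm
    by_cases hj : j = i
    · subst hj
      simp
      omega
    · simp [Ne.symm hj]
  refine ⟨monomial (m - Finsupp.single i 1) (coeff m f), ?_⟩
  rw [X, monomial_mul, h1, one_mul]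

lemma coeff_of_X_dvd (i : Fin 3) (f : MvPolynomial (Fin 3) k) (h : X i ∣ f)
    (m : Fin 3 →₀ ℕ) (hm : coeff m f ≠ 0) : m i ≠ 0 := by
  classical
  obtain ⟨g, rfl⟩ := h
  rw [coeff_X_mul'] at hm
  split_ifs at hm with h1
  · exact Finsupp.mem_support_iff.mp h1
  · exact absurd rfl hm

lemma pderiv_coeff_zero [CharZero k] (i : Fin 3) (f : MvPolynomial (Fin 3) k) (h : pderiv i f = 0)
    (m : Fin 3 →₀ ℕ) (hm : coeff m f ≠ 0) : m i = 0 := by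
  by_contra hi
  have h1 : m - Finsupp.single i 1 + Finsupp.single i 1 = m := by
    ext j
    by_cases hj : j = i
    · subst hj
      simp at hi ⊢
      omega
    · simp [Ne.symm hj]
  have := congrArg (coeff (m - Finsupp.single i 1)) h
  rw [coeff_pderiv, h1, coeff_zero] at this
  rcases mul_eq_zero.mp this with h2 | h2
  · exact hm h2
  · exact absurd h2 (Nat.cast_add_one_ne_zero _)

lemma exists_weights (T : Finset (ℤ × ℤ)) (hT : T.Nonempty) (h : ∀ t ∈ T, 0 < t.2 ∧ t.2 < t.1) :
    ∃ w1 w2 : ℤ, 0 < w2 ∧ w2 < w1 ∧ IsCoprime w1 w2 ∧ (∀ t ∈ T, t.2 * w1 ≤ t.1 * w2) ∧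
      ∃ t ∈ T, t.2 * w1 = t.1 * w2 := by
  obtain ⟨t, ht, hmin⟩ := T.exists_min_image (fun t => (t.1 / t.2 : ℚ)) hT
  obtain ⟨t1, t2⟩ := h t ht
  have hw2 : (0 : ℤ) < ((t.1 / t.2 : ℚ).den : ℤ) := by exact_mod_cast Rat.den_pos _
  have hr : ((t.1 / t.2 : ℚ).num : ℚ) = (t.1 / t.2 : ℚ) * ((t.1 / t.2 : ℚ).den : ℚ) :=
    (Rat.mul_den_eq_num _).symm
  set r : ℚ := (t.1 / t.2 : ℚ) with hrdef
  have hd : (0 : ℚ) < (r.den : ℚ) := by exact_mod_cast hw2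
  refine ⟨r.num, r.den, hw2, ?_, ?_, ?_, t, ht, ?_⟩
  · have h1 : (1 : ℚ) < r := by
      rw [hrdef, one_lt_div (by exact_mod_cast t1)]
      exact_mod_cast t2
    have : ((r.den : ℤ) : ℚ) < (r.num : ℚ) := by
      rw [hr]
      push_cast
      nlinarith
    exact_mod_cast this
  · exact Int.isCoprime_iff_nat_coprime.mpr r.reduced
  · intro s hs
    have h1 := hmin s hs
    have hs2 : (0 : ℚ) < (s.2 : ℚ) := by exact_mod_cast (h s hs).1
    rw [le_div_iff₀ hs2] at h1
    have : (s.2 : ℚ) * (r.num : ℚ) ≤ (s.1 : ℚ) * (r.den : ℚ) := by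
      rw [hr]
      nlinarith
    exact_mod_cast this
  · have ht2 : (t.2 : ℚ) ≠ 0 := by exact_mod_cast t1.ne'
    have : (t.2 : ℚ) * (r.num : ℚ) = (t.1 : ℚ) * (r.den : ℚ) := by
      rw [hr]
      have : (t.2 : ℚ) * r = t.1 := by rw [hrdef]; field_simp
      linear_combination (r.den : ℚ) * this
    exact_mod_cast this

/-- Case of two homogeneous gradings. -/
lemma step_two [CharZero k] (p : ℕ) (hp : p.Prime) (w1 w2 : ℤ) (hw2 : 0 < w2) (hw : w2 < w1)
    (hcop : IsCoprime w1 w2)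
    (D : Derivation k (MvPolynomial (Fin 3) k) (MvPolynomial (Fin 3) k)) (hD : IsLND D)
    (h0 : D (X 0) = 0)
    (h1 : ∀ m, coeff m (D (X 1)) ≠ 0 → wt w1 w2 m = w1 + ((p - 1) * w2 - w1))
    (h2 : ∀ m, coeff m (D (X 2)) ≠ 0 → wt w1 w2 m = w2 + ((p - 1) * w2 - w1))
    (h1' : ∀ m, coeff m (D (X 1)) ≠ 0 → m 0 + m 1 + m 2 = p - 1)
    (h2' : ∀ m, coeff m (D (X 2)) ≠ 0 → m 0 + m 1 + m 2 = p - 1)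
    (hc : coeff (Finsupp.single 2 (p - 1)) (D (X 1)) ≠ 0)
    (hne : D (X 2) ≠ 0 ∨ ∃ m, coeff m (D (X 1)) ≠ 0 ∧ m 1 ≠ 0) :
    w1 = p ∧ w2 = 1 := by
  have hp2 := hp.two_le
  obtain ⟨-, hq⟩ := q_ker w1 w2 _ D hD h0 h1 h2
  set q := (w1 : MvPolynomial (Fin 3) k) * X 1 * D (X 2) - (w2 : MvPolynomial (Fin 3) k) * X 2 * D (X 1)
    with hqdef
  have hCi : ∀ w : ℤ, (w : MvPolynomial (Fin 3) k) = C (w : k) := fun w => by simp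
  have hcoef : ∀ m, coeff m q = (w1 : k) * coeff m (X 1 * D (X 2)) -
      (w2 : k) * coeff m (X 2 * D (X 1)) := by
    intro m
    rw [hqdef, coeff_sub, hCi, hCi, mul_assoc, mul_assoc, coeff_C_mul, coeff_C_mul]
  have hw2k : (w2 : k) ≠ 0 := by exact_mod_cast hw2.ne'
  have hq0 : q ≠ 0 := by
    intro h
    have := hcoef (Finsupp.single 2 1 + Finsupp.single 2 (p - 1))
    rw [h, coeff_zero, coeff_X_mul] at this
    have h3 : coeff (Finsupp.single 2 1 + Finsupp.single 2 (p - 1)) (X 1 * D (X 2)) = 0 := by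
      by_contra h4
      have := coeff_of_X_dvd 1 _ (Dvd.intro _ rfl) _ h4
      simp at this
    rw [h3, mul_zero, zero_sub, eq_comm, neg_eq_zero] at this
    exact mul_ne_zero hw2k hc this
  have hb0 : D (X 2) ≠ 0 := by
    intro hb
    rcases hne with h | ⟨m, hm, hm1⟩
    · exact h hb
    · have hDa : D (D (X 1)) = 0 := by
        apply lnd_ker_factor D hD hq0 hq
        rw [hqdef, hb, mul_zero, zero_sub, dvd_neg]
        exact Dvd.intro_left _ rfl
      have x1 := der_expand D (D (X 1))
      rw [Fin.sum_univ_three, h0, hb, hDa, mul_zero, mul_zero, zero_add, add_zero] at x1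
      rcases mul_eq_zero.mp x1.symm with h | h
      · exact hm1 (pderiv_coeff_zero 1 _ h m hm)
      · rw [h, coeff_zero] at hm
        exact hm rfl
  have hnd : ¬ (X 2 ∣ q) := fun h => hb0 (lnd_ker_factor D hD hq0 hq h)
  obtain ⟨m, hm, hm2⟩ : ∃ m, coeff m q ≠ 0 ∧ m 2 = 0 := by
    by_contra hcon
    push Not at hcon
    exact hnd (X_dvd_of_coeff 2 q hcon)
  have hqwt : ∀ m, coeff m q ≠ 0 → wt w1 w2 m = p * w2 := by
    classical
    intro m hm
    rw [hcoef, coeff_X_mul', coeff_X_mul'] at hm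
    by_cases c1 : coeff m (X 1 * D (X 2)) = 0
    · rw [coeff_X_mul'] at c1
      rw [c1, mul_zero, zero_sub, neg_ne_zero] at hm
      split_ifs at hm with hs
      · have := h1 _ (right_ne_zero_of_mul hm)
        have e1 : m - Finsupp.single 2 1 + Finsupp.single 2 1 = m := by
          apply tsub_add_cancel_of_le
          rw [Finsupp.single_le_iff]
          have := Finsupp.mem_support_iff.mp hs
          omega
        rw [← e1, wt_add, wt_single2, this]
        ring
      · simp at hm
    · rw [coeff_X_mul'] at c1
      split_ifs at c1 with hs
      · have := h2 _ c1
        have e1 : m - Finsupp.single 1 1 + Finsupp.single 1 1 = m := by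
          apply tsub_add_cancel_of_le
          rw [Finsupp.single_le_iff]
          have := Finsupp.mem_support_iff.mp hs
          omega
        rw [← e1, wt_add, wt_single1, this]
        ring
      · simp at c1
  have hw1p : w1 = p := by
    have := hqwt m hm
    rw [wt, hm2] at this
    have hdvd : w1 ∣ (p : ℤ) * w2 := ⟨m 1, by rw [← this]; simp⟩
    have hdvd2 : w1 ∣ (p : ℤ) := hcop.dvd_of_dvd_mul_right hdvd
    have hn : w1.natAbs ∣ p := by
      have := Int.natAbs_dvd_natAbs.mpr hdvd2
      simpa using this
    rcases (Nat.dvd_prime hp).mp hn with h | h <;> omega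
  refine ⟨hw1p, ?_⟩
  by_contra hw21
  subst hw1p
  -- D Z is divisible by Y
  have d2 : (X 1 : MvPolynomial (Fin 3) k) ∣ D (X 2) := by
    apply X_dvd_of_coeff
    intro m hm hm1
    have e1 := h2 m hm
    have e2 := h2' m hm
    rw [wt, hm1] at e1
    have hdvd : (p : ℤ) ∣ w2 * m 2 := ⟨w2 - 1, by push_cast at e1; linarith⟩
    have hdvd2 : (p : ℤ) ∣ m 2 := hcop.dvd_of_dvd_mul_left hdvd
    have h3 : p ∣ m 2 := by exact_mod_cast hdvd2
    have h4 : m 2 = 0 := Nat.eq_zero_of_dvd_of_lt h3 (by omega)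
    rw [h4] at e1
    push_cast at e1
    have : (p : ℤ) * (w2 - 1) = 0 := by linarith
    rcases mul_eq_zero.mp this with h | h
    · omega
    · omega
  have d1 : (X 2 : MvPolynomial (Fin 3) k) ∣ D (X 1) := by
    apply X_dvd_of_coeff
    intro m hm hm1
    have e1 := h1 m hm
    have e2 := h1' m hm
    rw [wt, hm1] at e1
    have hdvd : (p : ℤ) ∣ w2 * (p - 1) := ⟨m 1, by push_cast at e1; linarith⟩
    have hdvd2 : (p : ℤ) ∣ (p - 1) := hcop.dvd_of_dvd_mul_left hdvd
    have := Int.le_of_dvd (by omega) hdvd2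
    omega
  have ha0 : D (X 1) ≠ 0 := by
    intro h
    rw [h, coeff_zero] at hc
    exact hc rfl
  exact hb0 (lnd_cross D hD d1 d2 ha0)

lemma homog_coeff (D : Derivation k (MvPolynomial (Fin 3) k) (MvPolynomial (Fin 3) k)) (d : ℕ)
    (h : IsHomogDer D d) (i : Fin 3) (m : Fin 3 →₀ ℕ) (hm : coeff m (D (X i)) ≠ 0) :
    m 0 + m 1 + m 2 = 1 + d := by
  have := h 1 (X i) (isHomogeneous_X k i) hm
  rw [← this, Finsupp.weight_apply, Finsupp.sum_fintype _ _ (by simp), Fin.sum_univ_three]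
  simp

lemma not_irred_aux (D : Derivation k (MvPolynomial (Fin 3) k) (MvPolynomial (Fin 3) k))
    (h : IsIrred D) (hd : ∀ i, (X 0 : MvPolynomial (Fin 3) k) ∣ D (X i)) : False := by
  have hu := h (X 0) (by
    rw [Ideal.span_le]
    rintro _ ⟨f, rfl⟩
    rw [SetLike.mem_coe, Ideal.mem_span_singleton, der_expand]
    exact Finset.dvd_sum fun i _ => (hd i).mul_left _)
  exact (X_prime : Prime (X 0 : MvPolynomial (Fin 3) k)).not_isUnit hu

lemma coordSys_swap : IsCoordSys (k := k) ![X 0, X 2, X 1] := by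
  refine ⟨renameEquiv k (Equiv.swap 1 2), ?_⟩
  intro i
  fin_cases i
  · simp [Equiv.swap_apply_of_ne_of_ne]
  · simp
  · simp

lemma coordSys_rank : IsCoordSys (k := k) ![X 1, X 2, X 0] := by
  refine ⟨renameEquiv k (finRotate 3), ?_⟩
  intro i
  fin_cases i
  · simp
  · simp
  · simp

lemma core1 [CharZero k] (p : ℕ) (hp : p.Prime)
    (D : Derivation k (MvPolynomial (Fin 3) k) (MvPolynomial (Fin 3) k))
    (hlnd : IsLND D) (hirr : IsIrred D) (hrank : HasRank2 D)
    (hhom : IsHomogDer D (p - 2)) (h0 : D (X 0) = 0) (hX2 : X 0 ∣ D (X 2)) :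
    IsTriangularizable D := by
  classical
  have hp2 := hp.two_le
  have hdeg : ∀ i m, coeff m (D (X i)) ≠ 0 → m 0 + m 1 + m 2 = p - 1 := by
    intro i m hm
    have := homog_coeff D _ hhom i m hm
    omega
  have F3 : ∀ m, coeff m (D (X 2)) ≠ 0 → m 0 ≠ 0 := fun m hm => coeff_of_X_dvd 0 _ hX2 m hm
  have F4 : D (X 2) ≠ 0 := fun h => hrank.2 ⟨_, coordSys_rank, h, h0⟩
  -- first step
  have F1 : ∀ m, coeff m (D (X 1)) ≠ 0 → m 0 = 0 → m 1 = 0 := by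
    have hl : IsLND (topDer 1 1 ((p : ℤ) - 2) D) := by
      apply topDer_isLND _ _ _ _ hlnd
      intro i m hm
      have := hdeg i m hm
      fin_cases i
      · simp only [Fin.zero_eta] at hm
        rw [h0, coeff_zero] at hm
        exact absurd rfl hm
      · simp only [Fin.mk_one, wt_single1]
        rw [wt]
        omega
      · simp only [Fin.reduceFinMk, wt_single2]
        rw [wt]
        omega
    have t0 : topDer 1 1 ((p : ℤ) - 2) D (X 0) = 0 := by
      ext m
      rw [topDer_X, coeff_restr, h0]
      simp
    have t2 : topDer 1 1 ((p : ℤ) - 2) D (X 2) = 0 := by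
      ext m
      rw [coeff_zero]
      by_contra hm
      rw [topDer_X] at hm
      obtain ⟨hm1, hm2⟩ := coeff_restr_ne hm
      have e1 := hdeg 2 m hm2
      have e2 := F3 m hm2
      rw [wt_single2, wt] at hm1
      omega
    have t1 : ∀ m, coeff m (topDer 1 1 ((p : ℤ) - 2) D (X 1)) ≠ 0 → m 0 = 0 ∧ m 1 + m 2 = p - 1 := by
      intro m hm
      rw [topDer_X] at hm
      obtain ⟨hm1, hm2⟩ := coeff_restr_ne hm
      have e1 := hdeg 1 m hm2
      rw [wt_single1, wt] at hm1
      omega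
    obtain ⟨r1, -, -⟩ := step_one (p - 1) (by omega) _ hl t0 t1 (by simp [t2])
    have x1 := der_expand (topDer 1 1 ((p : ℤ) - 2) D) (topDer 1 1 ((p : ℤ) - 2) D (X 1))
    rw [Fin.sum_univ_three, t0, t2, r1, mul_zero, mul_zero, zero_add, add_zero] at x1
    intro m hm hm0
    have e1 := hdeg 1 m hm
    have hm' : coeff m (topDer 1 1 ((p : ℤ) - 2) D (X 1)) ≠ 0 := by
      rw [topDer_X, coeff_restr_pos]
      · exact hm
      · rw [wt_single1, wt]
        omega
    rcases mul_eq_zero.mp x1.symm with h | h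
    · exact pderiv_coeff_zero 1 _ h m hm'
    · rw [h, coeff_zero] at hm'
      exact absurd rfl hm'
  have F2 : coeff (Finsupp.single 2 (p - 1)) (D (X 1)) ≠ 0 := by
    intro hc
    apply not_irred_aux D hirr
    intro i
    fin_cases i
    · simp [h0]
    · apply X_dvd_of_coeff
      intro m hm hm0
      simp only [Fin.mk_one] at hm
      have e1 := hdeg 1 m hm
      have e2 := F1 m hm hm0
      apply hm
      convert hc using 2
      ext j
      fin_cases j
      · simpa using hm0
      · simpa using e2
      · simp
        omega
    · exact hX2
  -- second step
  obtain ⟨w1, w2, hw2, hw, hcop, hall, t, ht, hteq⟩ := exists_weights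
    ((D (X 2)).support.image (fun m => ((p : ℤ) - m 2, (m 1 : ℤ) + 1)) ∪
      ((D (X 1)).support.filter (fun m => m 1 ≠ 0)).image
        (fun m => ((p : ℤ) - 1 - m 2, (m 1 : ℤ))))
    (by
      apply Finset.Nonempty.inl
      apply Finset.Nonempty.image
      rwa [Finset.nonempty_iff_ne_empty, Ne, support_eq_empty])
    (by
      intro t ht
      rw [Finset.mem_union, Finset.mem_image, Finset.mem_image] at ht
      rcases ht with ⟨m, hm, rfl⟩ | ⟨m, hm, rfl⟩
      · rw [mem_support_iff] at hm
        have e1 := hdeg 2 m hm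
        have e2 := F3 m hm
        constructor
        · simp only; omega
        · simp only; omega
      · rw [Finset.mem_filter, mem_support_iff] at hm
        have e1 := hdeg 1 m hm.1
        have e2 : m 0 ≠ 0 := fun h => hm.2 (F1 m hm.1 h)
        have := hm.2
        constructor
        · simp only; omega
        · simp only; omega)
  have I2 : ∀ m, coeff m (D (X 2)) ≠ 0 → ((m 1 : ℤ) + 1) * w1 ≤ ((p : ℤ) - m 2) * w2 := by
    intro m hm
    exact hall _ (Finset.mem_union_left _ (Finset.mem_image_of_mem _ (mem_support_iff.mpr hm)))
  have I1 : ∀ m, coeff m (D (X 1)) ≠ 0 → (m 1 : ℤ) * w1 ≤ ((p : ℤ) - 1 - m 2) * w2 := by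
    intro m hm
    by_cases h1 : m 1 = 0
    · rw [h1]
      have e1 := hdeg 1 m hm
      have : (0 : ℤ) ≤ (p : ℤ) - 1 - m 2 := by omega
      have := mul_nonneg this hw2.le
      simpa using this
    · exact hall _ (Finset.mem_union_right _ (Finset.mem_image_of_mem _
        (Finset.mem_filter.mpr ⟨mem_support_iff.mpr hm, h1⟩)))
  have hl : IsLND (topDer w1 w2 (((p : ℤ) - 1) * w2 - w1) D) := by
    apply topDer_isLND _ _ _ _ hlnd
    intro i m hm
    fin_cases i
    · simp only [Fin.zero_eta] at hm
      rw [h0, coeff_zero] at hm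
      exact absurd rfl hm
    · simp only [Fin.mk_one, wt_single1] at hm ⊢
      have := I1 m hm
      rw [wt]
      linarith
    · simp only [Fin.reduceFinMk, wt_single2] at hm ⊢
      have := I2 m hm
      rw [wt]
      linarith
  obtain ⟨rfl, rfl⟩ := step_two p hp w1 w2 hw2 hw hcop _ hl
    (by
      ext m
      rw [topDer_X, coeff_restr, h0]
      simp)
    (by
      intro m hm
      rw [topDer_X] at hm
      have := (coeff_restr_ne hm).1
      rwa [wt_single1] at this)
    (by
      intro m hm
      rw [topDer_X] at hm
      have := (coeff_restr_ne hm).1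
      rwa [wt_single2] at this)
    (by
      intro m hm
      rw [topDer_X] at hm
      exact hdeg 1 m (coeff_restr_ne hm).2)
    (by
      intro m hm
      rw [topDer_X] at hm
      exact hdeg 2 m (coeff_restr_ne hm).2)
    (by
      rw [topDer_X, coeff_restr_pos]
      · exact F2
      · rw [wt_single1, wt]
        have : ((p - 1 : ℕ) : ℤ) = (p : ℤ) - 1 := by omega
        simp [this]
        ring)
    (by
      rw [Finset.mem_union, Finset.mem_image, Finset.mem_image] at ht
      rcases ht with ⟨m, hm, rfl⟩ | ⟨m, hm, rfl⟩
      · left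
        rw [mem_support_iff] at hm
        intro h
        have h3 := congrArg (coeff m) h
        rw [topDer_X, coeff_restr_pos, coeff_zero] at h3
        · exact hm h3
        · rw [wt_single2, wt]
          simp only at hteq
          linarith
      · right
        rw [Finset.mem_filter, mem_support_iff] at hm
        refine ⟨m, ?_, hm.2⟩
        rw [topDer_X, coeff_restr_pos]
        · exact hm.1
        · rw [wt_single1, wt]
          simp only at hteq
          linarith)
  refine ⟨_, coordSys_swap, ⟨0, by simpa using h0⟩, ?_, ?_⟩
  · simp only [Matrix.cons_val_one, Matrix.cons_val_zero]
    rw [(D (X 2)).as_sum]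
    refine Subalgebra.sum_mem _ fun m hm => ?_
    rw [mem_support_iff] at hm
    have e1 := I2 m hm
    have e2 : m 1 = 0 := by
      by_contra h
      have : (1 : ℤ) ≤ m 1 := by omega
      nlinarith
    have e3 : m 2 = 0 := by
      rw [e2] at e1
      push_cast at e1
      omega
    rw [monomial_eq, Finsupp.prod_fintype _ _ (by simp), Fin.prod_univ_three, e2, e3, pow_zero,
      pow_zero, mul_one, mul_one]
    exact mul_mem (Subalgebra.algebraMap_mem _ _) (pow_mem (Algebra.subset_adjoin (by simp)) _)
  · simp only [Matrix.cons_val_one, Matrix.cons_val_zero, Matrix.cons_val]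
    rw [(D (X 1)).as_sum]
    refine Subalgebra.sum_mem _ fun m hm => ?_
    rw [mem_support_iff] at hm
    have e1 := I1 m hm
    have e2 : m 1 = 0 := by
      by_contra h
      have : (1 : ℤ) ≤ m 1 := by omega
      nlinarith
    rw [monomial_eq, Finsupp.prod_fintype _ _ (by simp), Fin.prod_univ_three, e2, pow_zero,
      mul_one]
    exact mul_mem (Subalgebra.algebraMap_mem _ _)
      (mul_mem (pow_mem (Algebra.subset_adjoin (by simp)) _)
        (pow_mem (Algebra.subset_adjoin (by simp)) _))

end Core

section Conj

variable {k : Type*} [Field k]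

/-- The conjugate `σ⁻¹ D σ`. -/
noncomputable def conjDer (σ : MvPolynomial (Fin 3) k ≃ₐ[k] MvPolynomial (Fin 3) k)
    (D : Derivation k (MvPolynomial (Fin 3) k) (MvPolynomial (Fin 3) k)) :
    Derivation k (MvPolynomial (Fin 3) k) (MvPolynomial (Fin 3) k) :=
  Derivation.mk' (σ.symm.toLinearMap ∘ₗ (D : MvPolynomial (Fin 3) k →ₗ[k] _) ∘ₗ σ.toLinearMap)
    (by
      intro a b
      simp)

lemma conjDer_apply (σ : MvPolynomial (Fin 3) k ≃ₐ[k] MvPolynomial (Fin 3) k)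
    (D : Derivation k (MvPolynomial (Fin 3) k) (MvPolynomial (Fin 3) k)) (f) :
    conjDer σ D f = σ.symm (D (σ f)) := rfl

lemma conjDer_iter (σ : MvPolynomial (Fin 3) k ≃ₐ[k] MvPolynomial (Fin 3) k)
    (D : Derivation k (MvPolynomial (Fin 3) k) (MvPolynomial (Fin 3) k)) (n : ℕ) (f) :
    (⇑(conjDer σ D))^[n] f = σ.symm ((⇑D)^[n] (σ f)) := by
  induction n generalizing f with
  | zero => simp
  | succ n ih => simp [Function.iterate_succ_apply, ih, conjDer_apply]

lemma conj_lnd (σ : MvPolynomial (Fin 3) k ≃ₐ[k] MvPolynomial (Fin 3) k)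
    (D : Derivation k (MvPolynomial (Fin 3) k) (MvPolynomial (Fin 3) k)) (h : IsLND D) :
    IsLND (conjDer σ D) := by
  intro f
  obtain ⟨n, hn⟩ := h (σ f)
  exact ⟨n, by rw [conjDer_iter, hn, map_zero]⟩

lemma conj_irr (σ : MvPolynomial (Fin 3) k ≃ₐ[k] MvPolynomial (Fin 3) k)
    (D : Derivation k (MvPolynomial (Fin 3) k) (MvPolynomial (Fin 3) k)) (h : IsIrred D) :
    IsIrred (conjDer σ D) := by
  intro b hb
  have := h (σ b) (by
    rw [Ideal.span_le] at hb ⊢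
    rintro _ ⟨f, rfl⟩
    have h1 := hb ⟨σ.symm f, rfl⟩
    rw [SetLike.mem_coe, Ideal.mem_span_singleton] at h1 ⊢
    rw [conjDer_apply] at h1
    have h2 := map_dvd σ h1
    simpa using h2)
  simpa using this

lemma coordSys_map (σ : MvPolynomial (Fin 3) k ≃ₐ[k] MvPolynomial (Fin 3) k)
    {V : Fin 3 → MvPolynomial (Fin 3) k} (h : IsCoordSys V) : IsCoordSys (fun i => σ (V i)) := by
  obtain ⟨τ, hτ⟩ := h
  exact ⟨τ.trans σ, fun i => by simp [hτ]⟩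

lemma conj_rank (σ : MvPolynomial (Fin 3) k ≃ₐ[k] MvPolynomial (Fin 3) k)
    (D : Derivation k (MvPolynomial (Fin 3) k) (MvPolynomial (Fin 3) k)) (h : HasRank2 D) :
    HasRank2 (conjDer σ D) := by
  obtain ⟨⟨V, hV, hV2⟩, h2⟩ := h
  refine ⟨⟨_, coordSys_map σ.symm hV, ?_⟩, ?_⟩
  · simp [conjDer_apply, hV2]
  · rintro ⟨W, hW, hW1, hW2⟩
    refine h2 ⟨_, coordSys_map σ hW, ?_, ?_⟩
    · simpa [conjDer_apply] using hW1
    · simpa [conjDer_apply] using hW2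

lemma conj_homog (σ : MvPolynomial (Fin 3) k ≃ₐ[k] MvPolynomial (Fin 3) k)
    (D : Derivation k (MvPolynomial (Fin 3) k) (MvPolynomial (Fin 3) k)) (d : ℕ)
    (h : IsHomogDer D d)
    (h1 : ∀ n f, f.IsHomogeneous n → (σ f).IsHomogeneous n)
    (h2 : ∀ n f, f.IsHomogeneous n → (σ.symm f).IsHomogeneous n) :
    IsHomogDer (conjDer σ D) d := by
  intro i f hf
  exact h2 _ _ (h _ _ (h1 _ _ hf))

lemma conj_triang (σ : MvPolynomial (Fin 3) k ≃ₐ[k] MvPolynomial (Fin 3) k)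
    (D : Derivation k (MvPolynomial (Fin 3) k) (MvPolynomial (Fin 3) k))
    (h : IsTriangularizable (conjDer σ D)) : IsTriangularizable D := by
  obtain ⟨V, hV, ⟨c, hc⟩, h1, h2⟩ := h
  have key : ∀ (S : Set (MvPolynomial (Fin 3) k)) (f), conjDer σ D f ∈ Algebra.adjoin k S →
      D (σ f) ∈ Algebra.adjoin k (σ '' S) := by
    intro S f hf
    have : σ (conjDer σ D f) ∈ (Algebra.adjoin k S).map (σ : _ →ₐ[k] _) :=
      ⟨_, hf, rfl⟩
    rw [AlgHom.map_adjoin] at this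
    simpa [conjDer_apply] using this
  refine ⟨_, coordSys_map σ hV, ⟨c, ?_⟩, ?_, ?_⟩
  · rw [conjDer_apply] at hc
    have := congrArg σ hc
    rw [AlgEquiv.apply_symm_apply] at this
    rw [this]
    exact σ.commutes c
  · simpa using key _ _ h1
  · simpa [Set.image_insert_eq] using key _ _ h2

/-- linear substitution -/
noncomputable def linSub (M : Matrix (Fin 3) (Fin 3) k) :
    MvPolynomial (Fin 3) k →ₐ[k] MvPolynomial (Fin 3) k :=
  aeval (fun i => ∑ j, C (M i j) * X j)

lemma linSub_X (M : Matrix (Fin 3) (Fin 3) k) (i : Fin 3) :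
    linSub M (X i) = ∑ j, C (M i j) * X j := by
  rw [linSub, aeval_X]

lemma linSub_homog (M : Matrix (Fin 3) (Fin 3) k) (n : ℕ) (f) (hf : f.IsHomogeneous n) :
    (linSub M f).IsHomogeneous n := by
  have := hf.aeval (n := 1) (fun i => ∑ j, C (M i j) * X j) (fun i => by
    apply IsHomogeneous.sum
    intro j _
    exact (isHomogeneous_C_mul_X _ _))
  rw [one_mul] at this
  exact this

lemma linSub_comp (M N : Matrix (Fin 3) (Fin 3) k) (h : N * M = 1) :
    (linSub M).comp (linSub N) = AlgHom.id k _ := by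
  apply algHom_ext
  intro i
  rw [AlgHom.comp_apply, linSub_X, map_sum]
  have : ∀ j, linSub M (C (N i j) * X j) = ∑ l, C (N i j * M j l) * X l := by
    intro j
    rw [map_mul, linSub_X, Finset.mul_sum]
    have : linSub M (C (N i j)) = C (N i j) := by simp [linSub]
    rw [this]
    simp [mul_assoc]
  simp only [this]
  rw [Finset.sum_comm]
  have h2 : ∀ l, ∑ j, C (N i j * M j l) * (X l : MvPolynomial (Fin 3) k) =
      C ((1 : Matrix (Fin 3) (Fin 3) k) i l) * X l := by
    intro l
    rw [← Finset.sum_mul, ← map_sum, ← h, Matrix.mul_apply]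
  simp only [h2, Matrix.one_apply]
  simp

/-- linear automorphism -/
lemma exists_linEquiv (M : Matrix (Fin 3) (Fin 3) k) (h : M.det ≠ 0) :
    ∃ σ : MvPolynomial (Fin 3) k ≃ₐ[k] MvPolynomial (Fin 3) k,
      (∀ i, σ (X i) = ∑ j, C (M i j) * X j) ∧
      (∀ n f, f.IsHomogeneous n → (σ f).IsHomogeneous n) ∧
      (∀ n f, f.IsHomogeneous n → (σ.symm f).IsHomogeneous n) := by
  have hu : IsUnit M.det := isUnit_iff_ne_zero.mpr h
  refine ⟨AlgEquiv.ofAlgHom (linSub M) (linSub M⁻¹) (linSub_comp _ _ (Matrix.nonsing_inv_mul _ hu))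
    (linSub_comp _ _ (Matrix.mul_nonsing_inv _ hu)), ?_, ?_, ?_⟩
  · intro i
    exact linSub_X M i
  · intro n f hf
    exact linSub_homog M n f hf
  · intro n f hf
    exact linSub_homog _ n f hf

lemma core2 [CharZero k] (p : ℕ) (hp : p.Prime)
    (D : Derivation k (MvPolynomial (Fin 3) k) (MvPolynomial (Fin 3) k))
    (hlnd : IsLND D) (hirr : IsIrred D) (hrank : HasRank2 D)
    (hhom : IsHomogDer D (p - 2)) (h0 : D (X 0) = 0) :
    IsTriangularizable D := by
  classical
  have hp2 := hp.two_le
  have hdeg : ∀ i m, coeff m (D (X i)) ≠ 0 → m 0 + m 1 + m 2 = p - 1 := by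
    intro i m hm
    have := homog_coeff D _ hhom i m hm
    omega
  have hl : IsLND (topDer 1 1 ((p : ℤ) - 2) D) := by
    apply topDer_isLND _ _ _ _ hlnd
    intro i m hm
    have := hdeg i m hm
    fin_cases i
    · simp only [Fin.zero_eta] at hm
      rw [h0, coeff_zero] at hm
      exact absurd rfl hm
    · simp only [Fin.mk_one, wt_single1]
      rw [wt]
      omega
    · simp only [Fin.reduceFinMk, wt_single2]
      rw [wt]
      omega
  have t0 : topDer 1 1 ((p : ℤ) - 2) D (X 0) = 0 := by
    ext m
    rw [topDer_X, coeff_restr, h0]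
    simp
  have t1 : ∀ m, coeff m (topDer 1 1 ((p : ℤ) - 2) D (X 1)) ≠ 0 → m 0 = 0 ∧ m 1 + m 2 = p - 1 := by
    intro m hm
    rw [topDer_X] at hm
    obtain ⟨hm1, hm2⟩ := coeff_restr_ne hm
    have e1 := hdeg 1 m hm2
    rw [wt_single1, wt] at hm1
    omega
  have t2 : ∀ m, coeff m (topDer 1 1 ((p : ℤ) - 2) D (X 2)) ≠ 0 → m 0 = 0 ∧ m 1 + m 2 = p - 1 := by
    intro m hm
    rw [topDer_X] at hm
    obtain ⟨hm1, hm2⟩ := coeff_restr_ne hm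
    have e1 := hdeg 2 m hm2
    rw [wt_single2, wt] at hm1
    omega
  -- coefficients of the reduction
  have c1 : ∀ m, m 0 = 0 → coeff m (topDer 1 1 ((p : ℤ) - 2) D (X 1)) = coeff m (D (X 1)) := by
    intro m hm
    by_cases h : coeff m (D (X 1)) = 0
    · rw [topDer_X, coeff_restr, h, ite_self]
    · rw [topDer_X, coeff_restr_pos]
      have e1 := hdeg 1 m h
      rw [wt_single1, wt]
      omega
  have c2 : ∀ m, m 0 = 0 → coeff m (topDer 1 1 ((p : ℤ) - 2) D (X 2)) = coeff m (D (X 2)) := by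
    intro m hm
    by_cases h : coeff m (D (X 2)) = 0
    · rw [topDer_X, coeff_restr, h, ite_self]
    · rw [topDer_X, coeff_restr_pos]
      have e1 := hdeg 2 m h
      rw [wt_single2, wt]
      omega
  obtain ⟨-, -, r⟩ := step_one (p - 1) (by omega) _ hl t0 t1 t2
  by_cases hz : topDer 1 1 ((p : ℤ) - 2) D (X 2) = 0
  · apply core1 p hp D hlnd hirr hrank hhom h0
    apply X_dvd_of_coeff
    intro m hm hm0
    rw [← c2 m hm0, hz, coeff_zero] at hm
    exact hm rfl
  · obtain ⟨c, hc⟩ := r hz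
    obtain ⟨σ, hσ, s1, s2⟩ := exists_linEquiv (!![1, 0, 0; 0, 0, 1; 0, 1, -c] : Matrix _ _ k)
      (by simp [Matrix.det_fin_three])
    have hσ0 : σ (X 0) = X 0 := by rw [hσ]; simp [Fin.sum_univ_three]
    have hσ2 : σ (X 2) = X 1 - C c * X 2 := by rw [hσ]; simp [Fin.sum_univ_three, sub_eq_add_neg]
    have hσ0' : σ.symm (X 0) = X 0 := by
      rw [AlgEquiv.symm_apply_eq, hσ0]
    apply conj_triang σ
    apply core1 p hp _ (conj_lnd σ D hlnd) (conj_irr σ D hirr) (conj_rank σ D hrank)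
      (conj_homog σ D _ hhom s1 s2)
    · rw [conjDer_apply, hσ0, h0, map_zero]
    · rw [conjDer_apply, hσ2]
      have hd : (X 0 : MvPolynomial (Fin 3) k) ∣ D (X 1 - C c * X 2) := by
        apply X_dvd_of_coeff
        intro m hm hm0
        apply hm
        rw [map_sub, ← smul_eq_C_mul, Derivation.map_smul, coeff_sub, coeff_smul, smul_eq_mul, ← c1 m hm0,
          ← c2 m hm0, hc, coeff_C_mul, sub_self]
      have := map_dvd σ.symm hd
      rwa [hσ0'] at this

/-- a variable in the kernel gives a linear form in the kernel -/
lemma exists_linear (D : Derivation k (MvPolynomial (Fin 3) k) (MvPolynomial (Fin 3) k)) (d : ℕ)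
    (hhom : IsHomogDer D d) (V : Fin 3 → MvPolynomial (Fin 3) k) (hV : IsCoordSys V)
    (h2 : D (V 2) = 0) :
    ∃ c : Fin 3 → k, (∃ i, c i ≠ 0) ∧ D (∑ i, C (c i) * X i) = 0 := by
  classical
  refine ⟨fun i => coeff (Finsupp.single i 1) (V 2), ?_, ?_⟩
  · by_contra hcon
    push Not at hcon
    obtain ⟨σ, hσ⟩ := hV
    have e : conjDer σ.symm (pderiv 2) (V 2) = 1 := by
      rw [conjDer_apply, ← hσ 2]
      simp
    have e2 := der_expand (conjDer σ.symm (pderiv 2)) (V 2)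
    rw [e] at e2
    have e3 := congrArg (constantCoeff) e2
    rw [map_one, map_sum] at e3
    have : ∀ i : Fin 3, constantCoeff (pderiv i (V 2)) = 0 := by
      intro i
      rw [constantCoeff_eq, coeff_pderiv, zero_add, hcon i, zero_mul]
    simp [this] at e3
  · have hlin : (∑ i, C (coeff (Finsupp.single i 1) (V 2)) * X i : MvPolynomial (Fin 3) k) =
        homogeneousComponent 1 (V 2) := by
      ext m
      rw [coeff_homogeneousComponent, coeff_sum]
      simp only [coeff_C_mul, coeff_X]
      split_ifs with h
      · obtain ⟨i, rfl⟩ : ∃ i, m = Finsupp.single i 1 := by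
          rw [Finsupp.degree_eq_sum, Fin.sum_univ_three] at h
          have h3 : (m 0 = 1 ∧ m 1 = 0 ∧ m 2 = 0) ∨ (m 0 = 0 ∧ m 1 = 1 ∧ m 2 = 0) ∨
              (m 0 = 0 ∧ m 1 = 0 ∧ m 2 = 1) := by omega
          rcases h3 with h3 | h3 | h3
          · exact ⟨0, by ext j; fin_cases j <;> simp [h3]⟩
          · exact ⟨1, by ext j; fin_cases j <;> simp [h3]⟩
          · exact ⟨2, by ext j; fin_cases j <;> simp [h3]⟩
        rw [Finset.sum_eq_single i]
        · simp
        · intro b _ hb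
          rw [if_neg, mul_zero]
          intro h
          exact hb (Finsupp.single_left_injective one_ne_zero h)
        · simp
      · apply Finset.sum_eq_zero
        intro i _
        rw [if_neg, mul_zero]
        rintro rfl
        simp at h
    rw [hlin]
    have hs := sum_homogeneousComponent (V 2)
    have hs2 : D (V 2) = ∑ i ∈ Finset.range ((V 2).totalDegree + 1),
        D (homogeneousComponent i (V 2)) := by
      rw [← map_sum, hs]
    ext m
    rw [coeff_zero]
    by_contra hm
    have hdegm : ∀ i, coeff m (D (homogeneousComponent i (V 2))) ≠ 0 → i = 1 := by
      intro i hi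
      have h1 := hhom 1 _ (homogeneousComponent_isHomogeneous 1 (V 2)) hm
      have h2 := hhom i _ (homogeneousComponent_isHomogeneous i (V 2)) hi
      omega
    have h3 := congrArg (coeff m) hs2
    rw [h2, coeff_zero, coeff_sum, Finset.sum_eq_single 1] at h3
    · exact hm h3.symm
    · intro i _ hi
      by_contra h
      exact hi (hdegm i h)
    · intro hr
      rw [Finset.mem_range, not_lt] at hr
      rw [homogeneousComponent_eq_zero _ _ (by omega), map_zero, coeff_zero]

end Conj

/-- For a prime `p`, every irreducible homogeneous locally nilpotent derivation of
rank 2 and degree `p - 2` on `k[U,V,W]` is triangularizable. -/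
theorem prime_degree_implies_triangularizable {k : Type*} [Field k] [CharZero k]
    (p : ℕ) (hp : p.Prime)
    (D : Derivation k (MvPolynomial (Fin 3) k) (MvPolynomial (Fin 3) k))
    (hlnd : IsLND D) (hirr : IsIrred D) (hrank : HasRank2 D)
    (hhom : IsHomogDer D (p - 2)) :
    IsTriangularizable D := by
  obtain ⟨V, hV, hV2⟩ := hrank.1
  obtain ⟨c, ⟨i, hi⟩, hc⟩ := exists_linear D _ hhom V hV hV2
  obtain ⟨M, hM, hM0⟩ : ∃ M : Matrix (Fin 3) (Fin 3) k, M.det ≠ 0 ∧ ∀ j, M 0 j = c j := by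
    fin_cases i
    · refine ⟨!![c 0, c 1, c 2; 0, 1, 0; 0, 0, 1], ?_, ?_⟩
      · simpa [Matrix.det_fin_three] using hi
      · intro j; fin_cases j <;> rfl
    · refine ⟨!![c 0, c 1, c 2; 1, 0, 0; 0, 0, 1], ?_, ?_⟩
      · simpa [Matrix.det_fin_three] using hi
      · intro j; fin_cases j <;> rfl
    · refine ⟨!![c 0, c 1, c 2; 1, 0, 0; 0, 1, 0], ?_, ?_⟩
      · simpa [Matrix.det_fin_three] using hi
      · intro j; fin_cases j <;> rfl
  obtain ⟨σ, hσ, s1, s2⟩ := exists_linEquiv M hM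
  apply conj_triang σ
  apply core2 p hp _ (conj_lnd σ D hlnd) (conj_irr σ D hirr) (conj_rank σ D hrank)
    (conj_homog σ D _ hhom s1 s2)
  rw [conjDer_apply, hσ]
  simp only [hM0]
  rw [hc, map_zero]
end

section
/- Let k be a field of characteristic zero, B = k[U,V,W], and D an irreducible homogeneous locally nilpotent derivation of rank 2 and degree d ≥ 0 on B. If D is triangularizable, then there exist a linear system of variables {X,Y,Z} with 0 = deg_D(X) < deg_D(Y) < deg_D(Z), a nonzero constant γ ∈ k*, β ∈ k*, and a homogeneous polynomial f of degree d+1 in X, Y such that D = γ·Δ_{(X,P)} where P = Y^{d+2} + X·f(X,Y) + β·X^{d+1}·Z; moreover deg_D(Y) = 1 and deg_D(Z) = d+2. -/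
open MvPolynomial

lemma st_expand {k : Type*} [Field k]
    (D : Derivation k (MvPolynomial (Fin 3) k) (MvPolynomial (Fin 3) k))
    (p : MvPolynomial (Fin 3) k) :
    D p = pderiv 0 p * D (X 0) + pderiv 1 p * D (X 1) + pderiv 2 p * D (X 2) := by
  have : D = D (X 0) • pderiv 0 + D (X 1) • pderiv 1 + D (X 2) • pderiv 2 := by
    apply MvPolynomial.derivation_ext
    intro i
    fin_cases i <;> simp
  conv_lhs => rw [this]
  simp only [Derivation.add_apply, Derivation.smul_apply, smul_eq_mul]
  ring

lemma st_lex_le {a b : Fin 3 →₀ ℕ} (h : toLex a ≤ toLex b) :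
    a 0 ≤ b 0 ∧ (a 0 = b 0 → a 1 ≤ b 1) := by
  rcases h.eq_or_lt with h | h
  · have : a = b := toLex.injective h
    subst this; simp
  · obtain ⟨i, h1, h2⟩ := h
    change ∀ j, j < i → a j = b j at h1
    change a i < b i at h2
    fin_cases i
    · simp only [Fin.zero_eta] at h2; omega
    · have := h1 0 (by decide)
      simp only [Fin.mk_one] at h2
      omega
    · have := h1 0 (by decide)
      have := h1 1 (by decide)
      omega

def ZPos {k : Type*} [Field k] (p : MvPolynomial (Fin 3) k) : Prop :=
  ∃ m, coeff m p ≠ 0 ∧ 1 ≤ m 0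

lemma st_zpos_deg {k : Type*} [Field k] {p : MvPolynomial (Fin 3) k} (h : ZPos p) :
    coeff (MonomialOrder.lex.degree p) p ≠ 0 ∧ 1 ≤ (MonomialOrder.lex.degree p) 0 := by
  obtain ⟨m, hm, h0⟩ := h
  refine ⟨?_, ?_⟩
  · have : p ≠ 0 := by rintro rfl; simp at hm
    exact MonomialOrder.leadingCoeff_ne_zero_iff.2 this
  · have := MonomialOrder.lex.le_degree (mem_support_iff.2 hm)
    rw [MonomialOrder.lex_le_iff] at this
    exact h0.trans (st_lex_le this).1

lemma st_lex_step {k : Type*} [Field k] [CharZero k]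
    (D : Derivation k (MvPolynomial (Fin 3) k) (MvPolynomial (Fin 3) k))
    (c : k) (n : ℕ) (h2 : D (X 2) = 0) (h1 : D (X 1) = C c * X 2 ^ n)
    (hg : ZPos (D (X 0))) (p : MvPolynomial (Fin 3) k) (hp : ZPos p) : ZPos (D p) := by
  obtain ⟨hp1, hp2⟩ := st_zpos_deg hp
  obtain ⟨hg1, hg2⟩ := st_zpos_deg hg
  set μ := MonomialOrder.lex.degree p with hμ
  set g := D (X 0) with hgdef
  set γ := MonomialOrder.lex.degree g with hγ
  have hα : ∃ α : Fin 3 →₀ ℕ, μ = α + Finsupp.single 0 1 :=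
    ⟨μ - Finsupp.single 0 1, by
      rw [tsub_add_cancel_of_le]; simpa [Finsupp.single_le_iff] using hp2⟩
  obtain ⟨α, hα⟩ := hα
  refine ⟨α + γ, ?_, ?_⟩
  · rw [st_expand D p, h2, mul_zero, add_zero, coeff_add]
    have e1 : coeff (α + γ) (pderiv 0 p * g) = coeff α (pderiv 0 p) * coeff γ g := by
      apply MonomialOrder.lex.coeff_mul_of_add_of_degree_le _ le_rfl
      rw [MonomialOrder.degree_le_iff]
      intro b hb
      rw [mem_support_iff, coeff_pderiv] at hb
      have := MonomialOrder.lex.le_degree (mem_support_iff.2 (left_ne_zero_of_mul hb))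
      rw [← hμ, hα, map_add, map_add] at this
      exact le_of_add_le_add_right this
    have e2 : coeff (α + γ) (pderiv 1 p * D (X 1)) = 0 := by
      have : pderiv 1 p * D (X 1) = pderiv 1 p * monomial (Finsupp.single 2 n) c := by
        rw [h1, C_mul_X_pow_eq_monomial]
      rw [this, coeff_mul_monomial']
      split_ifs with hle
      · rw [coeff_pderiv]
        by_contra hne
        have hne := left_ne_zero_of_mul (left_ne_zero_of_mul hne)
        have := MonomialOrder.lex.le_degree (mem_support_iff.2 hne)
        rw [MonomialOrder.lex_le_iff, ← hμ, hα] at this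
        have := st_lex_le this
        simp at this
        omega
      · rfl
    rw [e1, e2, add_zero, coeff_pderiv, ← hα]
    refine mul_ne_zero (mul_ne_zero hp1 ?_) hg1
    exact Nat.cast_add_one_ne_zero _
  · simp; omega

lemma st_no_zpos {k : Type*} [Field k] [CharZero k]
    (D : Derivation k (MvPolynomial (Fin 3) k) (MvPolynomial (Fin 3) k))
    (hl : IsLND D)
    (c : k) (n : ℕ) (h2 : D (X 2) = 0) (h1 : D (X 1) = C c * X 2 ^ n) :
    ¬ ZPos (D (X 0)) := by
  intro hg
  have key : ∀ n, ZPos ((⇑D)^[n] (X 0)) := by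
    intro n
    induction n with
    | zero => exact ⟨Finsupp.single 0 1, by simp [coeff_X], by simp⟩
    | succ n ih =>
      rw [Function.iterate_succ_apply']
      exact st_lex_step D c _ h2 h1 hg _ ih
  obtain ⟨n, hn⟩ := hl (X 0)
  obtain ⟨m, hm, -⟩ := key n
  simp [hn] at hm

lemma st_Y {k : Type*} [Field k] [CharZero k] (d : ℕ)
    (D : Derivation k (MvPolynomial (Fin 3) k) (MvPolynomial (Fin 3) k))
    (hirr : ∀ b, b ∣ D (X 0) → b ∣ D (X 1) → IsUnit b)
    (h2 : D (X 2) = 0) (h11 : D (D (X 1)) = 0) (h1 : D (X 1) ≠ 0)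
    (hh1 : (D (X 1)).IsHomogeneous (d + 1)) :
    ∃ c : k, c ≠ 0 ∧ D (X 1) = C c * X 2 ^ (d + 1) := by
  set h := D (X 1) with hh
  have e : pderiv 0 h * D (X 0) + pderiv 1 h * h = 0 := by
    have := st_expand D h
    rw [h11, h2, mul_zero, add_zero, ← hh] at this
    exact this.symm
  have hrel : IsRelPrime h (D (X 0)) := fun b hb1 hb2 => hirr b hb2 hb1
  have hdvd : h ∣ pderiv 0 h := by
    apply hrel.dvd_of_dvd_mul_right
    exact ⟨- pderiv 1 h, by linear_combination e⟩
  have p0 : pderiv 0 h = 0 := by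
    by_contra hne
    obtain ⟨q, hq⟩ := hdvd
    have hq0 : q ≠ 0 := by rintro rfl; simp [hq] at hne
    have t1 := totalDegree_mul_of_isDomain h1 hq0
    rw [← hq, hh1.totalDegree h1] at t1
    have t2 := (hh1.pderiv (i := 0)).totalDegree hne
    simp at t2
    omega
  have p1 : pderiv 1 h = 0 := by
    rw [p0, zero_mul, zero_add] at e
    exact (mul_eq_zero.1 e).resolve_right h1
  have key : ∀ i : Fin 3, pderiv i h = 0 → ∀ m, coeff m h ≠ 0 → m i = 0 := by
    intro i hi m hm
    by_contra hmi
    have := congrArg (coeff (m - Finsupp.single i 1)) hi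
    rw [coeff_pderiv, tsub_add_cancel_of_le (by simpa [Finsupp.single_le_iff] using Nat.one_le_iff_ne_zero.2 hmi), coeff_zero] at this
    rcases mul_eq_zero.1 this with h | h
    · exact hm h
    · exact absurd h (Nat.cast_add_one_ne_zero _)
  have hm : ∀ m, coeff m h ≠ 0 → m = Finsupp.single 2 (d + 1) := by
    intro m hm
    have m0 := key 0 p0 m hm
    have m1 := key 1 p1 m hm
    have hd : m.degree = d + 1 := by
      by_contra hne
      exact hm (hh1.coeff_eq_zero hne)
    rw [Finsupp.degree_eq_sum, Fin.sum_univ_three] at hd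
    ext i
    fin_cases i <;> simp <;> omega
  have hform : h = monomial (Finsupp.single 2 (d + 1)) (coeff (Finsupp.single 2 (d + 1)) h) := by
    ext m
    rw [coeff_monomial]
    split_ifs with hc
    · rw [hc]
    · by_contra hne
      exact hc (hm m hne).symm
  refine ⟨coeff (Finsupp.single 2 (d + 1)) h, ?_, ?_⟩
  · intro h0
    rw [h0] at hform
    exact h1 (by rw [hform]; simp)
  · rw [C_mul_X_pow_eq_monomial, ← hform]

lemma st_Z {k : Type*} [Field k] [CharZero k] (d : ℕ)
    (g : MvPolynomial (Fin 3) k) (hg : g.IsHomogeneous (d + 1)) (hz : ¬ ZPos g) :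
    ∃ a : ℕ → k, g = ∑ j ∈ Finset.range (d + 2), C (a j) * X 2 ^ (d + 1 - j) * X 1 ^ j := by
  refine ⟨fun j => coeff (Finsupp.single 2 (d + 1 - j) + Finsupp.single 1 j) g, ?_⟩
  have e : ∀ (a : k) (i j : ℕ), (C a * X 2 ^ i * X 1 ^ j : MvPolynomial (Fin 3) k)
      = monomial (Finsupp.single 2 i + Finsupp.single 1 j) a := by
    intro a i j
    rw [C_mul_X_pow_eq_monomial, X_pow_eq_monomial, monomial_mul, mul_one]
  simp only [e]
  ext m
  rw [coeff_sum]
  simp only [coeff_monomial]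
  by_cases hm : coeff m g = 0
  · rw [hm, Finset.sum_eq_zero]
    intro j hj
    split_ifs with h
    · rw [h, hm]
    · rfl
  · have hd : m.degree = d + 1 := by
      by_contra hne
      exact hm (hg.coeff_eq_zero hne)
    have h0 : m 0 = 0 := by
      by_contra h0
      exact hz ⟨m, hm, by omega⟩
    rw [Finsupp.degree_eq_sum, Fin.sum_univ_three] at hd
    have hmm : Finsupp.single 2 (d + 1 - m 1) + Finsupp.single 1 (m 1) = m := by
      ext i
      fin_cases i <;> simp <;> omega
    rw [Finset.sum_eq_single (m 1)]
    · rw [if_pos hmm, hmm]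
    · intro j hj hne
      rw [if_neg]
      intro hc
      apply hne
      rw [← hc]; simp
    · intro hn
      simp at hn; omega

lemma st_core {k : Type*} [Field k] [CharZero k] (d : ℕ)
    (D : Derivation k (MvPolynomial (Fin 3) k) (MvPolynomial (Fin 3) k))
    (hl : IsLND D)
    (hirr : ∀ b, b ∣ D (X 0) → b ∣ D (X 1) → IsUnit b)
    (h2 : D (X 2) = 0) (h11 : D (D (X 1)) = 0) (h1 : D (X 1) ≠ 0)
    (hh1 : (D (X 1)).IsHomogeneous (d + 1)) (hh0 : (D (X 0)).IsHomogeneous (d + 1)) :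
    ∃ (c : k) (a : ℕ → k), c ≠ 0 ∧ a (d + 1) ≠ 0 ∧ D (X 1) = C c * X 2 ^ (d + 1) ∧
      D (X 0) = ∑ j ∈ Finset.range (d + 2), C (a j) * X 2 ^ (d + 1 - j) * X 1 ^ j := by
  obtain ⟨c, hc, hY⟩ := st_Y d D hirr h2 h11 h1 hh1
  obtain ⟨a, ha⟩ := st_Z d _ hh0 (st_no_zpos D hl c _ h2 hY)
  refine ⟨c, a, hc, ?_, hY, ha⟩
  intro h0
  have hu : IsUnit (X 2 : MvPolynomial (Fin 3) k) := by
    apply hirr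
    · rw [ha]
      apply Finset.dvd_sum
      intro j hj
      simp at hj
      by_cases hjd : j = d + 1
      · simp [hjd, h0]
      · exact Dvd.dvd.mul_right (Dvd.dvd.mul_left (dvd_pow_self _ (by omega)) _) _
    · rw [hY]
      exact Dvd.dvd.mul_left (dvd_pow_self _ (by omega)) _
  exact (MvPolynomial.X_prime (R := k) (i := (2 : Fin 3))).not_isUnit hu

lemma st_comp {k : Type*} [Field k] (d : ℕ)
    (D : Derivation k (MvPolynomial (Fin 3) k) (MvPolynomial (Fin 3) k))
    (hhom : IsHomogDer D d) (i : ℕ) (f : MvPolynomial (Fin 3) k) :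
    homogeneousComponent (i + d) (D f) = D (homogeneousComponent i f) := by
  have e : ∀ j, homogeneousComponent (i + d) (D (homogeneousComponent j f)) =
      if j = i then D (homogeneousComponent i f) else 0 := by
    intro j
    rw [homogeneousComponent_of_mem (hhom j _ (homogeneousComponent_isHomogeneous j f))]
    by_cases h : j = i
    · simp [h]
    · rw [if_neg (by omega), if_neg h]
  conv_lhs => rw [← sum_homogeneousComponent f]
  rw [map_sum, map_sum, Finset.sum_congr rfl (fun j _ => e j), Finset.sum_ite_eq']
  split_ifs with h
  · rfl
  · rw [homogeneousComponent_eq_zero, map_zero]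
    simp at h; omega

lemma st_const {k : Type*} [Field k] (d : ℕ)
    (D : Derivation k (MvPolynomial (Fin 3) k) (MvPolynomial (Fin 3) k))
    (hhom : IsHomogDer D d) (f : MvPolynomial (Fin 3) k) : constantCoeff (D f) = 0 := by
  have e : ∀ i, constantCoeff (D (X i)) = 0 := by
    intro i
    rw [constantCoeff_eq]
    apply (hhom 1 _ (isHomogeneous_X _ i)).coeff_eq_zero
    rw [map_zero]; omega
  rw [st_expand D f]
  simp [e]

noncomputable def linF {k : Type*} [Field k] (M : Matrix (Fin 3) (Fin 3) k) (i : Fin 3) :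
    MvPolynomial (Fin 3) k := ∑ j, C (M i j) * X j

lemma linF_hom {k : Type*} [Field k] (M : Matrix (Fin 3) (Fin 3) k) (i : Fin 3) :
    (linF M i).IsHomogeneous 1 :=
  IsHomogeneous.sum _ _ _ fun _ _ => isHomogeneous_C_mul_X _ _

lemma linF_one {k : Type*} [Field k] (i : Fin 3) :
    linF (1 : Matrix (Fin 3) (Fin 3) k) i = X i := by
  simp [linF, Matrix.one_apply, apply_ite]

lemma linF_comp {k : Type*} [Field k] (M N : Matrix (Fin 3) (Fin 3) k) (i : Fin 3) :
    aeval (linF M) (linF N i) = linF (N * M) i := by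
  simp only [linF, map_sum, map_mul, aeval_X, Matrix.mul_apply, Finset.sum_mul, Finset.mul_sum]
  rw [Finset.sum_comm]
  refine Finset.sum_congr rfl fun j _ => Finset.sum_congr rfl fun l _ => ?_
  simp [mul_assoc]

noncomputable def linE {k : Type*} [Field k] (M N : Matrix (Fin 3) (Fin 3) k)
    (h1 : N * M = 1) (h2 : M * N = 1) :
    MvPolynomial (Fin 3) k ≃ₐ[k] MvPolynomial (Fin 3) k :=
  AlgEquiv.ofAlgHom (aeval (linF M)) (aeval (linF N))
    (by apply MvPolynomial.algHom_ext; intro i; rw [AlgHom.comp_apply, aeval_X, linF_comp, h1, linF_one]; rfl)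
    (by apply MvPolynomial.algHom_ext; intro i; rw [AlgHom.comp_apply, aeval_X, linF_comp, h2, linF_one]; rfl)

lemma st_chain {k : Type*} [Field k] (V : Fin 3 → MvPolynomial (Fin 3) k) (j : Fin 3)
    (p : MvPolynomial (Fin 3) k) :
    pderiv j (aeval V p) = ∑ l, aeval V (pderiv l p) * pderiv j (V l) := by
  induction p using MvPolynomial.induction_on with
  | C a => simp
  | add p q hp hq => simp only [map_add, hp, hq, add_mul, Finset.sum_add_distrib]
  | mul_X p i h =>
    simp only [map_mul, aeval_X, Derivation.leibniz, smul_eq_mul, h, map_add, pderiv_X, add_mul,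
      Finset.sum_add_distrib, Finset.mul_sum]
    congr 1
    · simp [Pi.single_apply]
    · exact Finset.sum_congr rfl fun _ _ => by ring

lemma st_lin_comp {k : Type*} [Field k] (f : MvPolynomial (Fin 3) k) :
    homogeneousComponent 1 f = ∑ j, C (constantCoeff (pderiv j f)) * X j := by
  set p := homogeneousComponent 1 f with hp
  have hph : p.IsHomogeneous 1 := homogeneousComponent_isHomogeneous 1 f
  have := hph.sum_X_mul_pderiv
  rw [one_smul] at this
  rw [← this]
  refine Finset.sum_congr rfl fun j _ => ?_
  have h0 : (pderiv j p).IsHomogeneous 0 := hph.pderiv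
  have h1 := homogeneousComponent_eq_self h0
  rw [homogeneousComponent_zero] at h1
  rw [← h1, mul_comm, constantCoeff_eq, coeff_pderiv, coeff_pderiv, hp, coeff_homogeneousComponent]
  simp

lemma st_coord {k : Type*} [Field k] (V : Fin 3 → MvPolynomial (Fin 3) k) (hV : IsCoordSys V) :
    ∃ M N : Matrix (Fin 3) (Fin 3) k, N * M = 1 ∧ M * N = 1 ∧
      ∀ i, homogeneousComponent 1 (V i) = linF M i := by
  obtain ⟨σ, hσ⟩ := hV
  have hs : ∀ p, σ p = aeval V p := by
    intro p
    have : σ.toAlgHom = aeval V := by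
      apply MvPolynomial.algHom_ext; intro i; simp [hσ]
    exact DFunLike.congr_fun this p
  let M : Matrix (Fin 3) (Fin 3) k := Matrix.of fun i j => constantCoeff (pderiv j (V i))
  let N : Matrix (Fin 3) (Fin 3) k :=
    Matrix.of fun i l => constantCoeff (aeval V (pderiv l (σ.symm (X i))))
  have hNM : N * M = 1 := by
    ext i j
    have := st_chain V j (σ.symm (X i))
    rw [← hs, AlgEquiv.apply_symm_apply] at this
    have := congrArg constantCoeff this
    rw [map_sum] at this
    simp only [map_mul] at this
    rw [Matrix.mul_apply]
    simp only [M, N, Matrix.of_apply]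
    rw [← this, pderiv_X, Matrix.one_apply, Pi.single_apply]
    split_ifs <;> simp
  exact ⟨M, N, hNM, mul_eq_one_comm.1 hNM, fun i => st_lin_comp _⟩

lemma st_rev {k : Type*} [Field k] (V : Fin 3 → MvPolynomial (Fin 3) k) (hV : IsCoordSys V) :
    IsCoordSys ![V 2, V 1, V 0] := by
  obtain ⟨σ, hσ⟩ := hV
  refine ⟨(renameEquiv k (Equiv.swap (0 : Fin 3) 2)).trans σ, ?_⟩
  intro i
  fin_cases i <;> simp [hσ]
  rw [Equiv.swap_apply_of_ne_of_ne (by decide) (by decide)]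

noncomputable def conjD {k B : Type*} [Field k] [CommRing B] [Algebra k B] (σ : B ≃ₐ[k] B)
    (D : Derivation k B B) : Derivation k B B :=
  Derivation.mk' (σ.symm.toLinearMap ∘ₗ (D : B →ₗ[k] B) ∘ₗ σ.toLinearMap) (by
    intro a b
    simp)

lemma conjD_apply {k B : Type*} [Field k] [CommRing B] [Algebra k B] (σ : B ≃ₐ[k] B)
    (D : Derivation k B B) (b : B) : conjD σ D b = σ.symm (D (σ b)) := rfl

lemma conjD_iter {k B : Type*} [Field k] [CommRing B] [Algebra k B] (σ : B ≃ₐ[k] B)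
    (D : Derivation k B B) (b : B) (n : ℕ) :
    (⇑(conjD σ D))^[n] b = σ.symm ((⇑D)^[n] (σ b)) := by
  induction n with
  | zero => simp
  | succ n ih => rw [Function.iterate_succ_apply', Function.iterate_succ_apply', ih, conjD_apply]; simp

/-- The linear normal form. -/
lemma st_normal {k : Type*} [Field k] [CharZero k]
    (d : ℕ)
    (D : Derivation k (MvPolynomial (Fin 3) k) (MvPolynomial (Fin 3) k))
    (hlnd : IsLND D) (hirr : IsIrred D) (hrank : HasRank2 D)
    (hhom : IsHomogDer D d) (htri : IsTriangularizable D) :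
    ∃ M : Matrix (Fin 3) (Fin 3) k, M.det ≠ 0 ∧ IsCoordSys (linF M) ∧ D (linF M 2) = 0 ∧
      ∃ (c : k) (a : ℕ → k), c ≠ 0 ∧ a (d + 1) ≠ 0 ∧
        D (linF M 1) = C c * linF M 2 ^ (d + 1) ∧
        D (linF M 0) = ∑ j ∈ Finset.range (d + 2),
          C (a j) * linF M 2 ^ (d + 1 - j) * linF M 1 ^ j := by
  obtain ⟨V, hV, ⟨c, hc⟩, h1, -⟩ := htri
  have hc0 : c = 0 := by
    have := st_const d D hhom (V 0)
    rw [hc] at this; simpa using this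
  subst hc0
  rw [map_zero] at hc
  have hDD : D (D (V 1)) = 0 := by
    refine Algebra.adjoin_induction (p := fun x _ => D x = 0) ?_ ?_ ?_ ?_ h1
    · intro x hx
      rw [Set.mem_singleton_iff] at hx; rw [hx, hc]
    · intro r; exact D.map_algebraMap r
    · intro x y _ _ hx hy; rw [map_add, hx, hy, add_zero]
    · intro x y _ _ hx hy; rw [Derivation.leibniz, hx, hy]; simp
  obtain ⟨M, N, hNM, hMN, hM⟩ := st_coord _ (st_rev V hV)
  obtain ⟨σ, hσ, hsym⟩ : ∃ σ : MvPolynomial (Fin 3) k ≃ₐ[k] MvPolynomial (Fin 3) k,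
      (∀ i, σ (X i) = linF M i) ∧
      ∀ p n, p.IsHomogeneous n → (σ.symm p).IsHomogeneous n := by
    refine ⟨linE M N hNM hMN, fun i => by simp [linE], fun p n hp => ?_⟩
    have := hp.aeval (linF N) (linF_hom N)
    rw [one_mul] at this
    exact this
  have hL : IsCoordSys (linF M) := ⟨σ, hσ⟩
  have e2 : linF M 2 = homogeneousComponent 1 (V 0) := by rw [← hM]; simp
  have e1 : linF M 1 = homogeneousComponent 1 (V 1) := by rw [← hM]; simp
  have D2 : D (linF M 2) = 0 := by rw [e2, ← st_comp d D hhom, hc, map_zero]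
  have D11 : D (D (linF M 1)) = 0 := by
    rw [e1, ← st_comp d D hhom, ← st_comp d D hhom, hDD, map_zero]
  have D1 : D (linF M 1) ≠ 0 := fun h => hrank.2 ⟨linF M, hL, h, D2⟩
  have hhomL : ∀ i, (conjD σ D (X i)).IsHomogeneous (d + 1) := by
    intro i
    rw [conjD_apply, hσ]
    apply hsym
    rw [add_comm]
    exact hhom 1 _ (linF_hom M i)
  have hcore := st_core d (conjD σ D) ?_ ?_ ?_ ?_ ?_ (hhomL 1) (hhomL 0)
  · obtain ⟨c, a, hc, ha, hY, hZ⟩ := hcore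
    refine ⟨M, ?_, hL, D2, c, a, hc, ha, ?_, ?_⟩
    · intro h0
      have := congrArg Matrix.det hMN
      rw [Matrix.det_mul, h0] at this
      simp at this
    · rw [conjD_apply, hσ] at hY
      have := congrArg σ hY
      rw [AlgEquiv.apply_symm_apply] at this
      rw [this]
      simp [hσ]
      left
      exact σ.commutes c
    · rw [conjD_apply, hσ] at hZ
      have := congrArg σ hZ
      rw [AlgEquiv.apply_symm_apply] at this
      rw [this]
      simp [hσ]
      refine Finset.sum_congr rfl fun j _ => ?_
      congr 2
      exact σ.commutes _
  · intro b
    obtain ⟨n, hn⟩ := hlnd (σ b)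
    exact ⟨n, by rw [conjD_iter, hn, map_zero]⟩
  · intro b hb0 hb1
    have hall : ∀ p, b ∣ conjD σ D p := by
      intro p
      rw [st_expand]
      have : conjD σ D (X 2) = 0 := by rw [conjD_apply, hσ, D2, map_zero]
      rw [this, mul_zero, add_zero]
      exact dvd_add (Dvd.dvd.mul_left hb0 _) (Dvd.dvd.mul_left hb1 _)
    have hu : IsUnit (σ b) := by
      apply hirr
      rw [Ideal.span_le]
      rintro _ ⟨x, rfl⟩
      rw [SetLike.mem_coe, Ideal.mem_span_singleton]
      have := map_dvd σ (hall (σ.symm x))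
      rwa [conjD_apply, AlgEquiv.apply_symm_apply, AlgEquiv.apply_symm_apply] at this
    simpa using hu.map σ.symm
  · rw [conjD_apply, hσ, D2, map_zero]
  · rw [conjD_apply, conjD_apply, AlgEquiv.apply_symm_apply, hσ, D11, map_zero]
  · rw [conjD_apply, hσ]
    exact fun h => D1 (by simpa using h)

noncomputable def jacR {k : Type*} [Field k] (f g : MvPolynomial (Fin 3) k) :
    Derivation k (MvPolynomial (Fin 3) k) (MvPolynomial (Fin 3) k) :=
  (pderiv 1 f * pderiv 2 g - pderiv 2 f * pderiv 1 g) • pderiv 0 +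
  (pderiv 2 f * pderiv 0 g - pderiv 0 f * pderiv 2 g) • pderiv 1 +
  (pderiv 0 f * pderiv 1 g - pderiv 1 f * pderiv 0 g) • pderiv 2

lemma jac_eq {k : Type*} [Field k] (f g h : MvPolynomial (Fin 3) k) :
    jac f g h = jacR f g h := by
  simp [jac, jacR, Matrix.det_fin_three]
  ring

lemma jacR_swap {k : Type*} [Field k] (f g h : MvPolynomial (Fin 3) k) :
    jacR f g h = - jacR f h g := by
  simp [jacR]
  ring

lemma jacR_left {k : Type*} [Field k] (f g : MvPolynomial (Fin 3) k) :
    jacR f g f = 0 := by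
  simp [jacR]
  ring

lemma jacR_right {k : Type*} [Field k] (f g : MvPolynomial (Fin 3) k) :
    jacR f g g = 0 := by
  simp [jacR]
  ring

lemma pderiv_linF {k : Type*} [Field k] (M : Matrix (Fin 3) (Fin 3) k) (i j : Fin 3) :
    pderiv j (linF M i) = C (M i j) := by
  simp [linF, Pi.single_apply]

lemma jacR_linF {k : Type*} [Field k] (M : Matrix (Fin 3) (Fin 3) k) :
    jacR (linF M 2) (linF M 1) (linF M 0) = C (- M.det) := by
  simp [jacR, Matrix.det_fin_three, pderiv_linF]
  ring

lemma der_ext_coord {k : Type*} [Field k] (V : Fin 3 → MvPolynomial (Fin 3) k)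
    (hV : IsCoordSys V)
    (D E : Derivation k (MvPolynomial (Fin 3) k) (MvPolynomial (Fin 3) k))
    (h : ∀ i, D (V i) = E (V i)) (g : MvPolynomial (Fin 3) k) : D g = E g := by
  obtain ⟨σ, hσ⟩ := hV
  have : conjD σ D = conjD σ E := by
    apply MvPolynomial.derivation_ext
    intro i
    rw [conjD_apply, conjD_apply, hσ, h]
  have := DFunLike.congr_fun this (σ.symm g)
  rw [conjD_apply, conjD_apply] at this
  simpa using this

lemma der_mono {k B : Type*} [Field k] [CommRing B] [Algebra k B]
    (D : Derivation k B B) (u y h : B) (hu : D u = 0) (hy : D y = h) (hh : D h = 0) (j n : ℕ) :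
    (⇑D)^[n] (u * y ^ j) = u * (j.descFactorial n : ℕ) * y ^ (j - n) * h ^ n := by
  induction n with
  | zero => simp
  | succ n ih =>
    rw [Function.iterate_succ_apply', ih, Nat.descFactorial_succ]
    simp only [Derivation.leibniz, Derivation.leibniz_pow, hu, hy, hh, Derivation.map_natCast,
      smul_eq_mul, nsmul_eq_mul]
    push_cast
    rw [Nat.sub_sub]
    ring

lemma der_iter_sum {k B : Type*} [Field k] [CommRing B] [Algebra k B]
    (D : Derivation k B B) (s : Finset ℕ) (f : ℕ → B) (n : ℕ) :
    (⇑D)^[n] (∑ j ∈ s, f j) = ∑ j ∈ s, (⇑D)^[n] (f j) := by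
  induction n with
  | zero => simp
  | succ n ih => simp only [Function.iterate_succ_apply', ih, map_sum]

/-- Structure of irreducible homogeneous triangularizable LNDs of rank 2 and degree
`d` on `k[U,V,W]`: there is a linear system of variables `{X,Y,Z}` with
`0 = deg_D X < deg_D Y < deg_D Z` such that `D = γ·Δ_{(X,P)}` with
`P = Y^{d+2} + X f(X,Y) + β X^{d+1} Z`, `γ, β ∈ k*`, `f` homogeneous of degree
`d+1`; moreover `deg_D Y = 1` and `deg_D Z = d+2`. -/
theorem structure_triangularizable {k : Type*} [Field k] [CharZero k]
    (d : ℕ)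
    (D : Derivation k (MvPolynomial (Fin 3) k) (MvPolynomial (Fin 3) k))
    (hlnd : IsLND D) (hirr : IsIrred D) (hrank : HasRank2 D)
    (hhom : IsHomogDer D d) (htri : IsTriangularizable D) :
    ∃ V : Fin 3 → MvPolynomial (Fin 3) k, IsCoordSys V ∧
      (∀ i, (V i).IsHomogeneous 1) ∧
      ∃ (γ β : k) (f₀ : MvPolynomial (Fin 2) k), γ ≠ 0 ∧ β ≠ 0 ∧
        f₀.IsHomogeneous (d + 1) ∧
        (∀ g, D g = C γ * jac (V 0)
          ((V 1) ^ (d + 2) + V 0 * (aeval ![V 0, V 1] f₀)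
            + C β * (V 0) ^ (d + 1) * V 2) g) ∧
        D (V 0) = 0 ∧ ndeg D (V 1) 1 ∧ ndeg D (V 2) (d + 2) := by


  obtain ⟨M, hdet, hL, hx, c, a, hc, ha, hy, hz⟩ := st_normal d D hlnd hirr hrank hhom htri
  set x := linF M 2 with hxdef
  set y := linF M 1 with hydef
  set z := linF M 0 with hzdef
  have hJ : jacR x y z = C (-M.det) := jacR_linF M
  have hx0 : x ≠ 0 := by
    rintro h0
    obtain ⟨σ, hσ⟩ := hL
    have := hσ 2
    rw [← hxdef, h0] at this
    exact X_ne_zero (R := k) (2 : Fin 3) (σ.injective (by rw [this, map_zero]))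
  obtain ⟨δ, hδ, hδ0⟩ : ∃ δ : k, δ = -M.det ∧ δ ≠ 0 := ⟨_, rfl, neg_ne_zero.2 hdet⟩
  rw [← hδ] at hJ
  have hV : IsCoordSys ![x, y, z] := st_rev _ hL
  have hxh : x.IsHomogeneous 1 := linF_hom M 2
  have hyh : y.IsHomogeneous 1 := linF_hom M 1
  have hzh : z.IsHomogeneous 1 := linF_hom M 0
  clear_value x y z
  have hd2 : ((d : k) + 2) ≠ 0 := by exact_mod_cast Nat.succ_ne_zero (d + 1)
  let γ : k := a (d + 1) / ((d + 2) * δ)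
  have hγ : γ ≠ 0 := div_ne_zero ha (mul_ne_zero hd2 hδ0)
  let β : k := - c / (γ * δ)
  have hβ : β ≠ 0 := div_ne_zero (neg_ne_zero.2 hc) (mul_ne_zero hγ hδ0)
  let b : ℕ → k := fun j => a j / (γ * δ * (j + 1))
  let f₀ : MvPolynomial (Fin 2) k :=
    ∑ j ∈ Finset.range (d + 1), C (b j) * X 0 ^ (d - j) * X 1 ^ (j + 1)
  have hf₀ : f₀.IsHomogeneous (d + 1) := by
    apply IsHomogeneous.sum
    intro j hj
    have hj : j < d + 1 := by simpa using hj
    have := (isHomogeneous_C_mul_X_pow (b j) (0 : Fin 2) (d - j)).mul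
      (isHomogeneous_X_pow (R := k) (1 : Fin 2) (j + 1))
    rwa [show d - j + (j + 1) = d + 1 by omega] at this
  have haf : aeval ![x, y] f₀ =
      ∑ j ∈ Finset.range (d + 1), C (b j) * x ^ (d - j) * y ^ (j + 1) := by
    simp [f₀]
  have hf : ∀ T : Derivation k (MvPolynomial (Fin 3) k) (MvPolynomial (Fin 3) k), T x = 0 →
      T (aeval ![x, y] f₀) =
        ∑ j ∈ Finset.range (d + 1), C (b j * (j + 1)) * x ^ (d - j) * y ^ j * T y := by
    intro T hT
    rw [haf, map_sum]
    refine Finset.sum_congr rfl fun j _ => ?_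
    simp [Derivation.leibniz, Derivation.leibniz_pow, hT]
    ring
  set P := y ^ (d + 2) + x * (aeval ![x, y] f₀) + C β * x ^ (d + 1) * z with hP
  have hPy : jacR x P y = - (C β * x ^ (d + 1) * C δ) := by
    rw [jacR_swap, hP]
    simp only [map_add, Derivation.leibniz, Derivation.leibniz_pow, hf _ (jacR_left x y),
      jacR_left, jacR_right, hJ, derivation_C]
    simp
  have hPz : jacR x P z = C δ * (((d : MvPolynomial (Fin 3) k) + 2) * y ^ (d + 1) +
      x * ∑ j ∈ Finset.range (d + 1), C (b j * (j + 1)) * x ^ (d - j) * y ^ j) := by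
    have hT : jacR x z y = - C δ := by rw [jacR_swap, hJ]
    rw [jacR_swap, hP]
    simp only [map_add, Derivation.leibniz, Derivation.leibniz_pow, hf _ (jacR_left x z),
      jacR_left, jacR_right, hT, derivation_C, ← Finset.sum_mul]
    generalize (∑ j ∈ Finset.range (d + 1), C (b j * (j + 1)) * x ^ (d - j) * y ^ j) = S
    simp
    ring
  have hh : D (C c * x ^ (d + 1)) = 0 := by
    simp [Derivation.leibniz, Derivation.leibniz_pow, hx]
  have hh0 : C c * x ^ (d + 1) ≠ 0 := mul_ne_zero (by simpa using hc) (pow_ne_zero _ hx0)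
  have hiter : ∀ n, (⇑D)^[n + 1] z = ∑ j ∈ Finset.range (d + 2),
      C (a j) * x ^ (d + 1 - j) * ((j.descFactorial n : ℕ) : MvPolynomial (Fin 3) k) * y ^ (j - n) *
        (C c * x ^ (d + 1)) ^ n := by
    intro n
    rw [Function.iterate_succ_apply, hz, der_iter_sum]
    refine Finset.sum_congr rfl fun j _ => ?_
    apply der_mono D _ y _ _ hy hh
    simp [Derivation.leibniz, Derivation.leibniz_pow, hx]
  refine ⟨![x, y, z], hV, ?_, γ, β, f₀, hγ, hβ, hf₀, ?_, hx, ⟨?_, ?_⟩, ⟨?_, ?_⟩⟩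
  · intro i
    fin_cases i
    · exact hxh
    · exact hyh
    · exact hzh
  · intro g
    change D g = C γ * jac x P g
    rw [jac_eq]
    refine der_ext_coord _ hV D ((C γ : MvPolynomial (Fin 3) k) • jacR x P) ?_ g
    intro i
    fin_cases i
    · change D x = C γ * jacR x P x
      rw [hx, jacR_left, mul_zero]
    · change D y = C γ * jacR x P y
      have : c = -(γ * β * δ) := by simp only [β]; field_simp
      rw [hPy, hy]
      conv_lhs => rw [this]
      simp only [map_neg, map_mul]
      ring
    · change D z = C γ * jacR x P z
      have e1 : a (d + 1) = γ * δ * (d + 2) := by simp only [γ]; field_simp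
      have e2 : ∀ j : ℕ, a j = γ * δ * (b j * (j + 1)) := by
        intro j
        have : (j : k) + 1 ≠ 0 := Nat.cast_add_one_ne_zero j
        simp only [b]; field_simp
      rw [hPz, hz, Finset.sum_range_succ, mul_add (C δ), mul_add (C γ), Finset.mul_sum, Finset.mul_sum,
        Finset.mul_sum, add_comm, e1]
      congr 1
      · have h2 : (C (2 : k) : MvPolynomial (Fin 3) k) = 2 := map_ofNat C 2
        simp [h2]; ring
      · refine Finset.sum_congr rfl fun j hj => ?_
        have hj : j < d + 1 := by simpa using hj
        rw [e2 j, show d + 1 - j = d - j + 1 by omega]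
        simp only [map_mul]
        ring
  · change D y ≠ 0
    rw [hy]; exact hh0
  · change D (D y) = 0
    rw [hy]; exact hh
  · change (⇑D)^[d + 1 + 1] z ≠ 0
    rw [hiter, Finset.sum_range_succ, Finset.sum_eq_zero, zero_add]
    · refine mul_ne_zero (mul_ne_zero (mul_ne_zero (mul_ne_zero ?_ ?_) ?_) ?_) (pow_ne_zero _ hh0)
      · simpa using ha
      · simp
      · rw [Nat.descFactorial_self]
        exact_mod_cast Nat.factorial_ne_zero _
      · simp
    · intro j hj
      have hj : j < d + 1 := by simpa using hj
      rw [Nat.descFactorial_of_lt hj]; simp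
  · change (⇑D)^[d + 2 + 1] z = 0
    rw [hiter, Finset.sum_eq_zero]
    intro j hj
    have hj : j < d + 2 := by simpa using hj
    rw [Nat.descFactorial_of_lt hj]; simp
end
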